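/- arXiv:2212.12027 — 3 statements merged into one kernel-verified Lean document; each statement's English description precedes it below -/
import Mathlib

section
/- Let f : R → T be a pure ring homomorphism of commutative Noetherian rings, 𝔞 a proper ideal of R, and M a finitely generated R-module. Then grade(𝔞, M) ≥ grade(𝔞T, T ⊗_R M). -/
open CategoryTheory TensorProduct

noncomputable section

universe u

/-- The cohomological dimension `cd(𝔞, M)`: the largest `i` (in `ℕ∞`) such that the local
cohomology module `H^i_𝔞(M)` is nonzero. -/
noncomputable def cohDim {R : Type u} [CommRing R] (a : Ideal R)
    (M : Type u) [AddCommGroup M] [Module R M] : ℕ∞ :=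
  sSup ((fun i : ℕ => (i : ℕ∞)) ''
    {i : ℕ | Nontrivial ((localCohomology a i).obj (ModuleCat.of R M))})

/-- The grade `grade(𝔞, M)`: the least `i` (in `ℕ∞`) such that `Ext^i_R(R/𝔞, M) ≠ 0`. -/
noncomputable def relGrade {R : Type u} [CommRing R] (a : Ideal R)
    (M : Type u) [AddCommGroup M] [Module R M] : ℕ∞ :=
  sInf ((fun i : ℕ => (i : ℕ∞)) ''
    {i : ℕ | Nontrivial (((Ext R (ModuleCat.{u} R) i).obj
      (Opposite.op (ModuleCat.of R (R ⧸ a)))).obj (ModuleCat.of R M))})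

/-- `M` is `𝔞`-relative Cohen-Macaulay: `M = 𝔞M`, or `M ≠ 𝔞M` and `grade(𝔞,M) = cd(𝔞,M)`. -/
def IsRelCM {R : Type u} [CommRing R] (a : Ideal R)
    (M : Type u) [AddCommGroup M] [Module R M] : Prop :=
  a • (⊤ : Submodule R M) = ⊤ ∨
    (a • (⊤ : Submodule R M) ≠ ⊤ ∧ relGrade a M = cohDim a M)

/-- `M` is `𝔞`-relative maximal Cohen-Macaulay: `grade(𝔞,M) = cd(𝔞,R)`. -/
def IsRelMCM {R : Type u} [CommRing R] (a : Ideal R)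
    (M : Type u) [AddCommGroup M] [Module R M] : Prop :=
  relGrade a M = cohDim a R

/-- `M` is `𝔞`-relative Gorenstein: `Ext^i_R(R/𝔞, M) = 0` for all `i ≠ cd(𝔞,R)`. -/
def IsRelGorenstein {R : Type u} [CommRing R] (a : Ideal R)
    (M : Type u) [AddCommGroup M] [Module R M] : Prop :=
  ∀ i : ℕ, (i : ℕ∞) ≠ cohDim a R →
    Subsingleton (((Ext R (ModuleCat.{u} R) i).obj
      (Opposite.op (ModuleCat.of R (R ⧸ a)))).obj (ModuleCat.of R M))

/-- `M` is `𝔞`-relative regular: `M = 𝔞M`, or `M ≠ 𝔞M` and `𝔞` is generated by a sequence of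
length `cd(𝔞,R)` which is both an `M`-regular sequence and an `R`-regular sequence. -/
def IsRelRegular {R : Type u} [CommRing R] (a : Ideal R)
    (M : Type u) [AddCommGroup M] [Module R M] : Prop :=
  a • (⊤ : Submodule R M) = ⊤ ∨
    (a • (⊤ : Submodule R M) ≠ ⊤ ∧ ∃ rs : List R,
      (rs.length : ℕ∞) = cohDim a R ∧ Ideal.span {x | x ∈ rs} = a ∧
      RingTheory.Sequence.IsRegular M rs ∧ RingTheory.Sequence.IsRegular R rs)

/-- A ring map (given as an algebra) `R → T` is pure if `N → T ⊗[R] N`, `n ↦ 1 ⊗ n`,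
is injective for every `R`-module `N`. -/
def IsPureAlgebra (R T : Type u) [CommRing R] [CommRing T] [Algebra R T] : Prop :=
  ∀ (N : Type u) [AddCommGroup N] [Module R N],
    Function.Injective (fun n : N => (1 : T) ⊗ₜ[R] n)

theorem bridge_aux {R : Type u} [CommRing R] {X Y : ModuleCat.{u} R} (P : ProjectiveResolution X)
    (n : ℕ) :
    Subsingleton (((Ext R (ModuleCat.{u} R) n).obj (Opposite.op X)).obj Y) ↔
    ∀ f : P.complex.X n ⟶ Y, P.complex.d (n+1) n ≫ f = 0 →
      ∃ g : P.complex.X ((ComplexShape.down ℕ).next n) ⟶ Y,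
        P.complex.d n ((ComplexShape.down ℕ).next n) ≫ g = f := by
  rw [← ModuleCat.isZero_iff_subsingleton, (P.isoExt n Y).isZero_iff,
    ← HomologicalComplex.exactAt_iff_isZero_homology,
    HomologicalComplex.exactAt_iff' _ ((ComplexShape.up ℕ).prev n) n (n+1) rfl (by simp),
    ShortComplex.moduleCat_exact_iff]
  rfl

theorem bridge {R : Type u} [CommRing R] (X Y : ModuleCat.{u} R) (n : ℕ) :
    Subsingleton (((Ext R (ModuleCat.{u} R) n).obj (Opposite.op X)).obj Y) ↔
    Subsingleton (Abelian.Ext X Y n) := by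
  obtain ⟨P⟩ : Nonempty (ProjectiveResolution X) := HasProjectiveResolution.out
  rw [bridge_aux P]
  cases n with
  | zero =>
    have hs : ∀ g : P.complex.X ((ComplexShape.down ℕ).next 0) ⟶ Y,
        P.complex.d 0 ((ComplexShape.down ℕ).next 0) ≫ g = 0 := by
      intro g
      rw [P.complex.shape _ _ (by simp), Limits.zero_comp]
    rw [Abelian.Ext.addEquiv₀.subsingleton_congr]
    constructor
    · intro h
      refine subsingleton_of_forall_eq 0 fun (f : ((ChainComplex.single₀ _).obj X).X 0 ⟶ Y) => ?_
      obtain ⟨g, hg⟩ := h (P.π.f 0 ≫ f) (by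
        have h1 := P.complex_d_comp_π_f_zero
        have h2 := congrArg (fun q => q ≫ f) h1
        simp only [Category.assoc, Limits.zero_comp] at h2
        exact h2)
      rw [hs] at hg
      exact (cancel_epi (P.π.f 0)).1 (hg.symm.trans Limits.comp_zero.symm)
    · intro h f hf
      refine ⟨0, ?_⟩
      have h1 := P.exact₀.g_desc f hf
      have h2 : P.exact₀.desc f hf = 0 := h.elim _ _
      rw [hs, ← h1, h2, Limits.comp_zero]
  | succ n =>
    rw [show (ComplexShape.down ℕ).next (n+1) = n by simp]
    constructor
    · intro h
      refine subsingleton_of_forall_eq 0 fun x => ?_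
      obtain ⟨f, hf, rfl⟩ := P.extMk_surjective x _ rfl
      rw [P.extMk_eq_zero_iff _ _ _ _ n rfl]
      exact h f hf
    · intro h f hf
      rw [← P.extMk_eq_zero_iff f _ rfl hf n rfl]
      exact Subsingleton.elim _ _

open Abelian in
theorem ext_zero {R T : Type u} [CommRing R] [CommRing T] [Algebra R T] (a : Ideal R)
    (N : Type u) [AddCommGroup N] [Module R N] [Module T N] [IsScalarTower R T N] (i : ℕ)
    (x : T) (hx : x ∈ a.map (algebraMap R T))
    (y : Abelian.Ext (ModuleCat.of R (R ⧸ a)) (ModuleCat.of R N) i) :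
    y.comp (Ext.mk₀ (ModuleCat.ofHom ((LinearMap.lsmul T N x).restrictScalars R)))
      (add_zero i) = 0 := by
  induction hx using Submodule.span_induction generalizing y with
  | mem x h =>
    obtain ⟨r, hr, rfl⟩ := h
    have h1 : (ModuleCat.ofHom ((LinearMap.lsmul T N (algebraMap R T r)).restrictScalars R)) =
        r • 𝟙 (ModuleCat.of R N) := by
      ext n
      simp
    rw [h1]
    have := Ext.postcomp_smul_id_eq_zero_of_mem_annihilator (M := ModuleCat.of R N)
      (N := ModuleCat.of R (R ⧸ a)) (r := r) (by simpa [Ideal.annihilator_quotient] using hr) i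
    exact congrArg (fun f => f.hom y) this
  | zero =>
    simp [Ext.mk₀_zero]
  | add x z _ _ hx hz =>
    have h1 : (ModuleCat.ofHom ((LinearMap.lsmul T N (x + z)).restrictScalars R)) =
      (ModuleCat.ofHom ((LinearMap.lsmul T N x).restrictScalars R)) +
      (ModuleCat.ofHom ((LinearMap.lsmul T N z).restrictScalars R)) := by
      ext n
      simp
    rw [h1, Ext.mk₀_add, Ext.comp_add, hx, hz, add_zero]
  | smul t x _ hx =>
    have h1 : (ModuleCat.ofHom ((LinearMap.lsmul T N (t • x)).restrictScalars R)) =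
      (ModuleCat.ofHom ((LinearMap.lsmul T N x).restrictScalars R)) ≫
      (ModuleCat.ofHom ((LinearMap.lsmul T N t).restrictScalars R)) := by
      ext n
      simp [mul_smul, smul_comm t x]
    rw [h1, ← Ext.mk₀_comp_mk₀, ← Ext.comp_assoc_of_third_deg_zero, hx, Ext.zero_comp]

open Abelian in
theorem ext_step {R : Type u} [CommRing R] (X : ModuleCat.{u} R)
    (N P : Type u) [AddCommGroup N] [Module R N] [AddCommGroup P] [Module R P]
    (f : N →ₗ[R] N) (g : N →ₗ[R] P) (hex : Function.Exact f g) (hf : Function.Injective f)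
    (hg : Function.Surjective g) (i : ℕ)
    (h : ∀ j < i, Subsingleton (Abelian.Ext X (ModuleCat.of R P) j))
    (y : Abelian.Ext X (ModuleCat.of R N) i)
    (hy : y.comp (Ext.mk₀ (ModuleCat.ofHom f)) (add_zero i) = 0) : y = 0 := by
  let S : ShortComplex (ModuleCat.{u} R) :=
    ModuleCat.shortComplexOfCompEqZero f g hex.linearMap_comp_eq_zero
  have hS : S.ShortExact :=
    { exact := ModuleCat.shortComplex_exact _ hex
      mono_f := by
        rw [ModuleCat.mono_iff_injective]
        exact hf
      epi_g := by
        rw [ModuleCat.epi_iff_surjective]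
        exact hg }
  cases i with
  | zero =>
    have := hS.mono_f
    apply Ext.postcomp_mk₀_injective_of_mono _ S.f
    rw [map_zero]
    exact hy
  | succ i =>
    obtain ⟨z, hz⟩ := Ext.covariant_sequence_exact₁ _ hS y hy rfl
    have := h i (by omega)
    rw [← hz, show z = 0 from Subsingleton.elim (α := Abelian.Ext X (ModuleCat.of R P) i) z 0,
      Ext.zero_comp]

open Abelian in
theorem change_step {R T : Type u} [CommRing R] [CommRing T] [Algebra R T]
    (a : Ideal R) (n : ℕ)
    (N : Type u) [AddCommGroup N] [Module R N] [Module T N] [IsScalarTower R T N]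
    (P : Type u) [AddCommGroup P] [Module R P] [Module T P] [IsScalarTower R T P]
    (x : T) (hxa : x ∈ a.map (algebraMap R T)) (hx : Function.Injective (LinearMap.lsmul T N x))
    (g : N →ₗ[T] P) (hex : Function.Exact (LinearMap.lsmul T N x) g)
    (hg : Function.Surjective g)
    (h : ∀ i < n + 1, Subsingleton (Abelian.Ext (ModuleCat.of T (T ⧸ a.map (algebraMap R T)))
      (ModuleCat.of T N) i))
    (ih : (∀ i < n, Subsingleton (Abelian.Ext (ModuleCat.of T (T ⧸ a.map (algebraMap R T)))
      (ModuleCat.of T P) i)) →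
      ∀ i < n, Subsingleton (Abelian.Ext (ModuleCat.of R (R ⧸ a)) (ModuleCat.of R P) i)) :
    ∀ i < n + 1, Subsingleton (Abelian.Ext (ModuleCat.of R (R ⧸ a)) (ModuleCat.of R N) i) := by
  let S : ShortComplex (ModuleCat.{u} T) :=
    ModuleCat.shortComplexOfCompEqZero (LinearMap.lsmul T N x) g hex.linearMap_comp_eq_zero
  have hS : S.ShortExact :=
    { exact := ModuleCat.shortComplex_exact _ hex
      mono_f := by
        rw [ModuleCat.mono_iff_injective]
        exact hx
      epi_g := by
        rw [ModuleCat.epi_iff_surjective]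
        exact hg }
  have h2 := ih (by
    intro i hi
    have zero1 := AddCommGrpCat.isZero_of_iff_subsingleton.mpr (h i (by omega))
    have zero2 := AddCommGrpCat.isZero_of_iff_subsingleton.mpr (h (i + 1) (by omega))
    exact AddCommGrpCat.subsingleton_of_isZero <| ShortComplex.Exact.isZero_of_both_zeros
      ((Ext.covariant_sequence_exact₃' _ hS) i (i + 1) rfl)
      (zero1.eq_zero_of_src _) (zero2.eq_zero_of_tgt _))
  intro i hi
  refine subsingleton_of_forall_eq 0 fun y => ?_
  exact ext_step (ModuleCat.of R (R ⧸ a)) N P ((LinearMap.lsmul T N x).restrictScalars R)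
    (g.restrictScalars R) hex hx hg i (fun j hj => h2 j (by omega)) y (ext_zero a N i x hxa y)

open Abelian Pointwise in
theorem ext_base_change {R T : Type u} [CommRing R] [CommRing T] [Algebra R T] [IsNoetherianRing T]
    (a : Ideal R) (n : ℕ)
    (N : Type u) [AddCommGroup N] [Module R N] [Module T N] [IsScalarTower R T N]
    [Module.Finite T N]
    (h : ∀ i < n, Subsingleton (Abelian.Ext (ModuleCat.of T (T ⧸ a.map (algebraMap R T)))
      (ModuleCat.of T N) i)) :
    ∀ i < n, Subsingleton (Abelian.Ext (ModuleCat.of R (R ⧸ a)) (ModuleCat.of R N) i) := by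
  induction n generalizing N with
  | zero => simp
  | succ n ih =>
    have h0 : Subsingleton (ModuleCat.of T (T ⧸ a.map (algebraMap R T)) ⟶ ModuleCat.of T N) :=
      Ext.addEquiv₀.subsingleton_congr.mp (h 0 n.zero_lt_succ)
    have h1 : Subsingleton ((T ⧸ a.map (algebraMap R T)) →ₗ[T] N) :=
      (ModuleCat.homAddEquiv (M := ModuleCat.of T (T ⧸ a.map (algebraMap R T)))
        (N := ModuleCat.of T N)).symm.subsingleton
    obtain ⟨x, hxa, hx⟩ := IsSMulRegular.subsingleton_linearMap_iff.mp h1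
    rw [Ideal.annihilator_quotient] at hxa
    exact change_step a n N (N ⧸ (x • (⊤ : Submodule T N))) x hxa hx
      (x • (⊤ : Submodule T N)).mkQ (LinearMap.exact_lsmul_mkQ_smul_top N x)
      (Submodule.mkQ_surjective _) h (ih _)

theorem pure_extend {R T : Type u} [CommRing R] [CommRing T] [Algebra R T]
    (hpure : IsPureAlgebra R T) (M K F : Type u) [AddCommGroup M] [Module R M]
    [AddCommGroup K] [Module R K] [Module.Finite R K]
    [AddCommGroup F] [Module R F] [Module.Finite R F] [Module.Free R F]
    (ι : K →ₗ[R] F) (y : K →ₗ[R] M) (g : F →ₗ[R] T ⊗[R] M)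
    (h : g ∘ₗ ι = TensorProduct.mk R T M 1 ∘ₗ y) : ∃ g' : F →ₗ[R] M, g' ∘ₗ ι = y := by
  obtain ⟨n, π, hπ⟩ := Module.Finite.exists_fin' R K
  let res : (F →ₗ[R] M) →ₗ[R] ((Fin n → R) →ₗ[R] M) := LinearMap.lcomp R M (ι ∘ₗ π)
  let e := lTensorHomEquivHomLTensor R (Fin n → R) T M
  let e' := lTensorHomEquivHomLTensor R F T M
  have key : ∀ z : T ⊗[R] (F →ₗ[R] M), e (res.lTensor T z) = e' z ∘ₗ (ι ∘ₗ π) := by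
    intro z
    induction z with
    | zero => simp
    | add z w hz hw => rw [map_add, map_add, hz, hw, map_add, LinearMap.add_comp]
    | tmul t f =>
      apply LinearMap.ext
      intro v
      simp [e, e', res, lTensorHomEquivHomLTensor_apply]
  have h1 : (1 : T) ⊗ₜ[R] (y ∘ₗ π) = res.lTensor T (e'.symm g) := by
    apply e.injective
    rw [key, e'.apply_symm_apply, ← LinearMap.comp_assoc, h]
    apply LinearMap.ext
    intro v
    simp [e, lTensorHomEquivHomLTensor_apply]
  have h2 : (LinearMap.range res).mkQ (y ∘ₗ π) = 0 := by
    apply hpure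
    have h3 := congrArg ((LinearMap.range res).mkQ.lTensor T) h1
    rw [← LinearMap.comp_apply, ← LinearMap.lTensor_comp, LinearMap.range_mkQ_comp] at h3
    simpa using h3
  rw [Submodule.mkQ_apply, Submodule.Quotient.mk_eq_zero] at h2
  obtain ⟨g', hg'⟩ := h2
  refine ⟨g', ?_⟩
  apply LinearMap.ext
  intro k
  obtain ⟨v, rfl⟩ := hπ k
  exact LinearMap.congr_fun hg' v

open Abelian in
theorem pure_inj {R T : Type u} [CommRing R] [CommRing T] [Algebra R T] [IsNoetherianRing R]
    (hpure : IsPureAlgebra R T) (M : Type u) [AddCommGroup M] [Module R M] (i : ℕ)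
    (X : Type u) [AddCommGroup X] [Module R X] [Module.Finite R X]
    (y : Abelian.Ext (ModuleCat.of R X) (ModuleCat.of R M) i)
    (hy : y.comp (Ext.mk₀ (ModuleCat.ofHom (TensorProduct.mk R T M 1))) (add_zero i) = 0) :
    y = 0 := by
  induction i generalizing X with
  | zero =>
    have : Mono (ModuleCat.ofHom (TensorProduct.mk R T M 1)) := by
      rw [ModuleCat.mono_iff_injective]
      exact hpure M
    apply Ext.postcomp_mk₀_injective_of_mono _ (ModuleCat.ofHom (TensorProduct.mk R T M 1))
    rw [map_zero]
    exact hy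
  | succ i ih =>
    obtain ⟨n, π, hπ⟩ := Module.Finite.exists_fin' R X
    let S := π.shortComplexKer
    have hS : S.ShortExact := LinearMap.shortExact_shortComplexKer hπ
    have : Projective (ModuleCat.of R (Fin n → R)) :=
      ModuleCat.projective_of_free (Pi.basisFun R (Fin n))
    have hP : Projective S.X₂ := this
    obtain ⟨z, rfl⟩ := Ext.contravariant_sequence_exact₃ hS _ y
      (Ext.eq_zero_of_projective _) (add_comm 1 i)
    rw [Ext.comp_assoc_of_third_deg_zero] at hy
    obtain ⟨w, hw⟩ := Ext.contravariant_sequence_exact₁ hS _ _ _ hy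
    cases i with
    | succ i =>
      rw [Ext.eq_zero_of_projective w, Ext.comp_zero] at hw
      rw [ih (LinearMap.ker π) z hw.symm, Ext.comp_zero]
    | zero =>
      obtain ⟨w, rfl⟩ := Ext.addEquiv₀.symm.surjective w
      obtain ⟨z, rfl⟩ := Ext.addEquiv₀.symm.surjective z
      simp only [Ext.addEquiv₀_symm_apply, Ext.mk₀_comp_mk₀] at hw ⊢
      have hw' := congrArg ModuleCat.Hom.hom (Ext.addEquiv₀.symm.injective hw)
      obtain ⟨g', hg'⟩ := pure_extend hpure M (LinearMap.ker π) (Fin n → R)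
        (LinearMap.ker π).subtype z.hom w.hom hw'
      have hz : z = S.f ≫ ModuleCat.ofHom g' := by
        ext v
        exact (LinearMap.congr_fun hg' v).symm
      rw [hz, ← Ext.mk₀_comp_mk₀, hS.extClass_comp_assoc]

theorem stmt0 {R T : Type u} [CommRing R] [CommRing T] [Algebra R T]
    [IsNoetherianRing R] [IsNoetherianRing T]
    (hpure : IsPureAlgebra R T) (a : Ideal R) (ha : a ≠ ⊤)
    (M : Type u) [AddCommGroup M] [Module R M] [Module.Finite R M] :
    relGrade (a.map (algebraMap R T)) (T ⊗[R] M) ≤ relGrade a M := by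
  refine le_sInf ?_
  rintro _ ⟨n, hn, rfl⟩
  by_contra hlt
  have hT : ∀ i < n + 1, Subsingleton (Abelian.Ext (ModuleCat.of T (T ⧸ a.map (algebraMap R T)))
      (ModuleCat.of T (T ⊗[R] M)) i) := by
    intro i hi
    rw [← bridge]
    by_contra hne
    rw [not_subsingleton_iff_nontrivial] at hne
    refine hlt (le_trans (sInf_le ⟨i, hne, rfl⟩) ?_)
    exact Nat.cast_le.mpr (by omega)
  have hR := ext_base_change a (n + 1) (T ⊗[R] M) hT n (by omega)
  refine (not_subsingleton_iff_nontrivial.mpr hn) ?_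
  rw [bridge]
  exact subsingleton_of_forall_eq 0 fun y =>
    pure_inj hpure M n (R ⧸ a) y (Subsingleton.elim _ _)

end
end

section
/- Let f : R → T be a pure ring homomorphism of commutative Noetherian rings, 𝔞 a proper ideal of R, and M a finitely generated R-module. Then cd(𝔞, M) = cd(𝔞T, T ⊗_R M), where cd denotes cohomological dimension with respect to local cohomology. -/
open CategoryTheory TensorProduct

noncomputable section

universe u

namespace CDB
open Opposite Limits
variable {R : Type u} [CommRing R]

theorem opcongr {A B : (ModuleCat.{u} R)ᵒᵖ} {f g : A ⟶ B} (z : B.unop) (h : f = g) :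
    f.unop.hom z = g.unop.hom z := by rw [h]

/-- the functor Hom(-,Y) -/
abbrev FY (Y : ModuleCat.{u} R) : ModuleCat.{u} R ⥤ (ModuleCat.{u} R)ᵒᵖ :=
  ((linearYoneda R (ModuleCat.{u} R)).obj Y).rightOp

abbrev KP {X : ModuleCat.{u} R} (P : ProjectiveResolution X) (Y : ModuleCat.{u} R) :
    ChainComplex (ModuleCat.{u} R)ᵒᵖ ℕ :=
  ((FY Y).mapHomologicalComplex _).obj P.complex

def Rep {X : ModuleCat.{u} R} (P : ProjectiveResolution X) {Y : ModuleCat.{u} R} {n : ℕ}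
    (e : ((FY Y).leftDerived n).obj X |>.unop) (f : P.complex.X n ⟶ Y) : Prop :=
  ∃ z : (((KP P Y).opcycles n).unop : ModuleCat.{u} R),
    ((KP P Y).homologyι n).unop.hom z = (P.isoLeftDerivedObj (FY Y) n).inv.unop.hom e ∧
    ((KP P Y).pOpcycles n).unop.hom z = f

theorem Rep.exists_rep {X : ModuleCat.{u} R} (P : ProjectiveResolution X) {Y : ModuleCat.{u} R} {n : ℕ}
    (e : ((FY Y).leftDerived n).obj X |>.unop) : ∃ f, Rep P e f := by
  have : Function.Surjective ((KP P Y).homologyι n).unop.hom :=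
    (ModuleCat.epi_iff_surjective _).1 inferInstance
  obtain ⟨z, hz⟩ := this ((P.isoLeftDerivedObj (FY Y) n).inv.unop.hom e)
  exact ⟨_, z, hz, rfl⟩

theorem Rep.d_comp {X : ModuleCat.{u} R} {P : ProjectiveResolution X} {Y : ModuleCat.{u} R} {n : ℕ}
    {e : ((FY Y).leftDerived n).obj X |>.unop} {f} (h : Rep P e f) (m : ℕ) :
    P.complex.d m n ≫ f = 0 := by
  obtain ⟨z, hz, rfl⟩ := h
  have h1 := (KP P Y).d_pOpcycles m n
  have h2 := opcongr z h1
  exact h2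

theorem Rep.exists_class {X : ModuleCat.{u} R} (P : ProjectiveResolution X) {Y : ModuleCat.{u} R} {n : ℕ}
    (f : P.complex.X n ⟶ Y) (m : ℕ) (hm : n + 1 = m) (hf : P.complex.d m n ≫ f = 0) :
    ∃ e : (((FY Y).leftDerived n).obj X).unop, Rep P e f := by
  let f' : ModuleCat.of R R ⟶ ((KP P Y).X n).unop :=
    ModuleCat.ofHom (LinearMap.toSpanSingleton R (P.complex.X n ⟶ Y) f)
  have hk : (KP P Y).d m n ≫ f'.op = 0 := by
    apply Quiver.Hom.unop_inj
    ext
    change P.complex.d m n ≫ ((1:R) • f) = 0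
    simpa using hf
  let g := (KP P Y).descOpcycles f'.op m (by simp; exact hm) hk
  refine ⟨(P.isoLeftDerivedObj (FY Y) n).hom.unop.hom
     (((KP P Y).homologyι n).unop.hom (g.unop.hom (1:R))), g.unop.hom (1:R), ?_, ?_⟩
  · have := opcongr (((KP P Y).homologyι n).unop.hom (g.unop.hom (1:R))) (P.isoLeftDerivedObj (FY Y) n).inv_hom_id
    exact this.symm
  · have h1 := (KP P Y).p_descOpcycles f'.op m (by simp; exact hm) hk
    have h2 := opcongr (1:R) h1
    refine h2.trans ?_
    change (1:R) • f = f
    simp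

theorem Rep.eq_zero_iff {X : ModuleCat.{u} R} {P : ProjectiveResolution X} {Y : ModuleCat.{u} R} {n : ℕ}
    {e : ((FY Y).leftDerived n).obj X |>.unop} {f} (h : Rep P e f)  :
    e = 0 ↔ ∃ g : P.complex.X ((ComplexShape.down ℕ).next n) ⟶ Y,
      P.complex.d n _ ≫ g = f := by
  obtain ⟨z, hz, rfl⟩ := h
  let S := ShortComplex.mk ((KP P Y).homologyι n) ((KP P Y).fromOpcycles n ((ComplexShape.down ℕ).next n)) (by simp)
  have hS : S.Exact := S.exact_of_f_is_kernel ((KP P Y).homologyIsKernel n _ rfl)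
  have hS' := (ShortComplex.ShortExact.moduleCat_exact_iff_function_exact _).1 hS.unop
  have hinj : e = 0 ↔ (P.isoLeftDerivedObj (FY Y) n).inv.unop.hom e = 0 := by
    constructor
    · rintro rfl; simp
    · intro h0
      have := opcongr e (P.isoLeftDerivedObj (FY Y) n).hom_inv_id
      refine this.symm.trans ?_
      change (P.isoLeftDerivedObj (FY Y) n).hom.unop.hom ((P.isoLeftDerivedObj (FY Y) n).inv.unop.hom e) = 0
      rw [h0, map_zero]
  have hpf := (KP P Y).p_fromOpcycles n ((ComplexShape.down ℕ).next n)
  have hp : Function.Injective ((KP P Y).pOpcycles n).unop.hom :=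
    (ModuleCat.mono_iff_injective _).1 inferInstance
  rw [hinj, ← hz]
  refine (hS' z).trans ?_
  constructor
  · rintro ⟨g, rfl⟩
    exact ⟨g, (opcongr g hpf).symm⟩
  · rintro ⟨g, hg⟩
    refine ⟨g, hp ?_⟩
    rw [← hg]
    exact opcongr g hpf

theorem Rep.map {X X' : ModuleCat.{u} R} {P : ProjectiveResolution X} 
    {P' : ProjectiveResolution X'} {Y : ModuleCat.{u} R} {n : ℕ}
    {e : ((FY Y).leftDerived n).obj X |>.unop} {f} (h : Rep P e f) (g : X' ⟶ X) (φ : P'.Hom P g) :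
    Rep P' ((((FY Y).leftDerived n).map g).unop.hom e) (φ.hom.f n ≫ f) := by
  obtain ⟨z, hz, rfl⟩ := h
  let ψ := ((FY Y).mapHomologicalComplex (ComplexShape.down ℕ)).map φ.hom
  refine ⟨(HomologicalComplex.opcyclesMap ψ n).unop.hom z, ?_, ?_⟩
  · have h1 := HomologicalComplex.homologyι_naturality ψ n
    have h2 := opcongr z h1
    refine h2.symm.trans ?_
    have h3 := ProjectiveResolution.isoLeftDerivedObj_inv_naturality g P' P φ.hom φ.hom_f_zero_comp_π_f_zero (FY Y) n
    have h4 := opcongr e h3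
    refine Eq.trans ?_ h4.symm
    exact congrArg (fun w => (HomologicalComplex.homologyMap ψ n).unop.hom w) hz
  · have h1 := HomologicalComplex.p_opcyclesMap ψ n
    exact (opcongr z h1)

/-- The projection `R/a^s → R/a^t`. -/
def proj (a : Ideal R) {t s : ℕ} (h : t ≤ s) :
    ModuleCat.of R (R ⧸ a ^ s) ⟶ ModuleCat.of R (R ⧸ a ^ t) :=
  ModuleCat.ofHom (Submodule.mapQ _ _ LinearMap.id (Ideal.pow_le_pow_right h))

/-- Vanishing of local cohomology in terms of `Ext`. -/
def V (a : Ideal R) (i : ℕ) (N : ModuleCat.{u} R) : Prop :=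
  ∀ (t : ℕ) (e : Abelian.Ext (ModuleCat.of R (R ⧸ a ^ t)) N i),
    ∃ (s : ℕ) (h : t ≤ s), (Abelian.Ext.mk₀ (proj a h)).comp e (zero_add i) = 0

theorem extMk_eq_zero_iff' {X : ModuleCat.{u} R} (P : ProjectiveResolution X) {Y : ModuleCat.{u} R}
    {n : ℕ} (f : P.complex.X n ⟶ Y) (hf) : P.extMk f (n+1) rfl hf = 0 ↔
    ∃ g : P.complex.X ((ComplexShape.down ℕ).next n) ⟶ Y, P.complex.d n _ ≫ g = f := by
  cases n with
  | succ p =>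
    rw [P.extMk_eq_zero_iff f _ rfl hf p rfl]
    have : (ComplexShape.down ℕ).next (p+1) = p := (ComplexShape.down ℕ).next_eq' (by simp)
    rw [this]
  | zero =>
    constructor
    · intro h
      refine ⟨0, ?_⟩
      rw [← P.extEquivCohomologyClass.apply_eq_iff_eq,
        ProjectiveResolution.extEquivCohomologyClass_extMk,
        ProjectiveResolution.extEquivCohomologyClass_zero,
        CochainComplex.HomComplex.CohomologyClass.mk_eq_zero_iff,
        CochainComplex.HomComplex.Cocycle.toSingleMk_mem_coboundaries_iff _ _ _ _ _ 1 (by simp)] at h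
      obtain ⟨g, hg⟩ := h
      have h0 : g = 0 := (P.cochainComplex.isZero_of_isStrictlyLE 0 1 (by simp)).eq_of_src _ _
      rw [h0, comp_zero] at hg
      rw [comp_zero, ← cancel_epi (P.cochainComplexXIso (-(0:ℕ)) 0 rfl).hom, ← hg, comp_zero]
    · rintro ⟨g, hg⟩
      have : P.complex.d 0 ((ComplexShape.down ℕ).next 0) = 0 := P.complex.shape _ _ (by simp)
      rw [this, zero_comp] at hg
      subst hg
      simp

theorem vanish_iff {X X' : ModuleCat.{u} R} (g : X' ⟶ X) {Y : ModuleCat.{u} R} {n : ℕ} {P : ProjectiveResolution X}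
    {e : ((FY Y).leftDerived n).obj X |>.unop} {f} (h : Rep P e f) :
    (((FY Y).leftDerived n).map g).unop.hom e = 0 ↔
     (Abelian.Ext.mk₀ g).comp (P.extMk f (n+1) rfl (h.d_comp _)) (zero_add n) = 0 := by
  let P' := projectiveResolution X'
  let φ : P'.Hom P g := ⟨ProjectiveResolution.lift g P' P, by
    have := ProjectiveResolution.lift_commutes_zero g P' P
    exact this⟩
  rw [(h.map g φ).eq_zero_iff, ProjectiveResolution.mk₀_comp_extMk _ _ _ _ φ, extMk_eq_zero_iff']

theorem V_iff (a : Ideal R) (i : ℕ) (N : ModuleCat.{u} R) :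
    V a i N ↔ Subsingleton ((localCohomology a i).obj N) := by
  let D := localCohomology.diagram (localCohomology.idealPowersDiagram a) i
  have hc : IsColimit (((evaluation (ModuleCat.{u} R) (ModuleCat.{u} R)).obj N).mapCocone (colimit.cocone D)) :=
    isColimitOfPreserves _ (colimit.isColimit D)
  have hsm : PreservesFilteredColimitsOfSize.{0, 0} (forget (ModuleCat.{u} R)) :=
    preservesFilteredColimitsOfSize_shrink.{0, u, 0, u} _
  have hfil : PreservesColimitsOfShape (ℕᵒᵖ)ᵒᵖ (forget (ModuleCat.{u} R)) :=
    hsm.preserves_filtered_colimits _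
  let c := ((evaluation (ModuleCat.{u} R) (ModuleCat.{u} R)).obj N).mapCocone (colimit.cocone D)
  have key : ∀ (j : (ℕᵒᵖ)ᵒᵖ) (x : (((evaluation (ModuleCat.{u} R) (ModuleCat.{u} R)).obj N).obj (D.obj j) : ModuleCat.{u} R)),
      c.ι.app j x = 0 ↔ ∃ (k : (ℕᵒᵖ)ᵒᵖ) (f : j ⟶ k), ((D.map f).app N) x = 0 := by
    intro j x
    have := IsColimit.eq_iff' hc x 0
    rw [map_zero] at this
    refine this.trans ?_
    simp only [map_zero]
    rfl
  constructor
  · intro hV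
    rw [subsingleton_iff_forall_eq 0]
    intro y
    obtain ⟨j, e, rfl⟩ := Concrete.isColimit_exists_rep _ hc y
    obtain ⟨f, hf⟩ := Rep.exists_rep (projectiveResolution (ModuleCat.of R (R ⧸ a ^ j.unop.unop))) (n := i) (Y := N) e
    obtain ⟨s, hs, h0⟩ := hV _ (ProjectiveResolution.extMk _ f (i+1) rfl (hf.d_comp _))
    rw [← vanish_iff _ hf] at h0
    let ψ : j ⟶ op (op s) := (homOfLE hs).op.op
    exact (key j e).2 ⟨_, ψ, h0⟩
  · intro hs t e
    obtain ⟨f, hf, rfl⟩ := (projectiveResolution (ModuleCat.of R (R ⧸ a ^ t))).extMk_surjective e _ rfl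
    obtain ⟨e', he'⟩ := Rep.exists_class (projectiveResolution (ModuleCat.of R (R ⧸ a ^ t))) f _ rfl hf
    obtain ⟨k, g, hg⟩ := (key (op (op t)) e').1 (Subsingleton.elim (α := ((localCohomology a i).obj N)) _ _)
    refine ⟨k.unop.unop, g.unop.unop.le, ?_⟩
    rw [← vanish_iff _ he']
    exact hg
end CDB

namespace CDB
open Abelian
variable {R : Type u} [CommRing R]

theorem proj_comp (a : Ideal R) {t s r : ℕ} (h : t ≤ s) (h' : s ≤ r) :
    proj a h' ≫ proj a h = proj a (h.trans h') := by
  ext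
  rfl

theorem V_mono_elt {a : Ideal R} {i : ℕ} {N : ModuleCat.{u} R} {t s r : ℕ} (h : t ≤ s) (h' : s ≤ r)
    (e : Ext (ModuleCat.of R (R ⧸ a^t)) N i) :
    (Ext.mk₀ (proj a h')).comp ((Ext.mk₀ (proj a h)).comp e (zero_add i)) (zero_add i) =
    (Ext.mk₀ (proj a (h.trans h'))).comp e (zero_add i) := by
  rw [← proj_comp a h h', ← Ext.mk₀_comp_mk₀, Ext.comp_assoc_of_second_deg_zero]

theorem V_mid {a : Ideal R} {i : ℕ} {S : ShortComplex (ModuleCat.{u} R)} (hS : S.ShortExact)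
    (hA : V a i S.X₁) (hC : V a i S.X₃) : V a i S.X₂ := by
  intro t e
  obtain ⟨s, h, hs⟩ := hC t (e.comp (Ext.mk₀ S.g) (add_zero i))
  obtain ⟨x, hx⟩ := Ext.covariant_sequence_exact₂ _ hS ((Ext.mk₀ (proj a h)).comp e (zero_add i))
    (by rw [← hs, Ext.comp_assoc_of_third_deg_zero])
  obtain ⟨r, h', hr⟩ := hA s x
  refine ⟨r, h.trans h', ?_⟩
  rw [← V_mono_elt h h', ← hx, ← Ext.comp_assoc_of_third_deg_zero, hr, Ext.zero_comp]

theorem V_right {a : Ideal R} {i : ℕ} {S : ShortComplex (ModuleCat.{u} R)} (hS : S.ShortExact)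
    (hB : V a i S.X₂) (hA : V a (i+1) S.X₁) : V a i S.X₃ := by
  intro t e
  obtain ⟨s, h, hs⟩ := hA t (e.comp hS.extClass rfl)
  obtain ⟨x, hx⟩ := Ext.covariant_sequence_exact₃ _ hS ((Ext.mk₀ (proj a h)).comp e (zero_add i)) rfl
    (by rw [← hs, Ext.comp_assoc]; simp)
  obtain ⟨r, h', hr⟩ := hB s x
  refine ⟨r, h.trans h', ?_⟩
  rw [← V_mono_elt h h', ← hx, ← Ext.comp_assoc_of_third_deg_zero, hr, Ext.zero_comp]

theorem V_left {a : Ideal R} {i : ℕ} {S : ShortComplex (ModuleCat.{u} R)} (hS : S.ShortExact)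
    (hB : V a (i+1) S.X₂) (hC : V a i S.X₃) : V a (i+1) S.X₁ := by
  intro t e
  obtain ⟨s, h, hs⟩ := hB t (e.comp (Ext.mk₀ S.f) (add_zero _))
  obtain ⟨x, hx⟩ := Ext.covariant_sequence_exact₁ _ hS ((Ext.mk₀ (proj a h)).comp e (zero_add _)) 
    (by rw [← hs, Ext.comp_assoc_of_third_deg_zero]) rfl
  obtain ⟨r, h', hr⟩ := hC s x
  refine ⟨r, h.trans h', ?_⟩
  rw [← V_mono_elt h h', ← hx, ← Ext.comp_assoc _ _ _ (zero_add i) rfl (by omega), hr, Ext.zero_comp]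

/-- unbundled version -/
def VM (a : Ideal R) (i : ℕ) (N : Type u) [AddCommGroup N] [Module R N] : Prop :=
  V a i (ModuleCat.of R N)

section
variable {A B C : Type u} [AddCommGroup A] [AddCommGroup B] [AddCommGroup C]
  [Module R A] [Module R B] [Module R C]

/-- short complex of linear maps -/
abbrev SC (f : A →ₗ[R] B) (g : B →ₗ[R] C) (h : Function.Exact f g) :
    ShortComplex (ModuleCat.{u} R) :=
  ShortComplex.mk (ModuleCat.ofHom f) (ModuleCat.ofHom g)
    (by ext x; exact h.apply_apply_eq_zero x)

theorem SC_exact {f : A →ₗ[R] B} {g : B →ₗ[R] C} (hf : Function.Injective f)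
    (h : Function.Exact f g) (hg : Function.Surjective g) : (SC f g h).ShortExact :=
  ModuleCat.shortComplex_shortExact _ h hf hg

variable {a : Ideal R} {i : ℕ}

theorem VM.mid {f : A →ₗ[R] B} {g : B →ₗ[R] C} (hf : Function.Injective f)
    (h : Function.Exact f g) (hg : Function.Surjective g) (hA : VM a i A) (hC : VM a i C) :
    VM a i B := V_mid (SC_exact hf h hg) hA hC

theorem VM.right {f : A →ₗ[R] B} {g : B →ₗ[R] C} (hf : Function.Injective f)
    (h : Function.Exact f g) (hg : Function.Surjective g) (hB : VM a i B) (hA : VM a (i+1) A) :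
    VM a i C := V_right (SC_exact hf h hg) hB hA

theorem VM.left {f : A →ₗ[R] B} {g : B →ₗ[R] C} (hf : Function.Injective f)
    (h : Function.Exact f g) (hg : Function.Surjective g) (hB : VM a (i+1) B) (hC : VM a i C) :
    VM a (i+1) A := V_left (SC_exact hf h hg) hB hC

/-- retract -/
theorem VM.retract (f : A →ₗ[R] B) (g : B →ₗ[R] A) (h : g.comp f = LinearMap.id)
    (hB : VM a i B) : VM a i A := by
  intro t e
  obtain ⟨s, hts, hs⟩ := hB t (e.comp (Ext.mk₀ (ModuleCat.ofHom f)) (add_zero _))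
  refine ⟨s, hts, ?_⟩
  have h1 : ModuleCat.ofHom f ≫ ModuleCat.ofHom g = 𝟙 (ModuleCat.of R A) := by
    rw [← ModuleCat.ofHom_comp, h]; rfl
  have h2 := congrArg (fun z => z.comp (Ext.mk₀ (ModuleCat.ofHom g)) (add_zero _)) hs
  simpa only [Ext.comp_assoc_of_third_deg_zero, Ext.mk₀_comp_mk₀, h1, Ext.zero_comp, Ext.comp_mk₀_id] using h2

theorem VM.equiv (e : A ≃ₗ[R] B) (hB : VM a i B) : VM a i A :=
  hB.retract e.toLinearMap e.symm.toLinearMap (by ext; simp)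

theorem VM.equiv_iff (e : A ≃ₗ[R] B) : VM a i A ↔ VM a i B :=
  ⟨VM.equiv e.symm, VM.equiv e⟩

theorem VM.of_subsingleton [Subsingleton A] : VM a i A := by
  intro t e
  refine ⟨t, le_rfl, ?_⟩
  have : (𝟙 (ModuleCat.of R A)) = 0 := by ext x; exact Subsingleton.elim _ _
  have h2 : e.comp (Ext.mk₀ (𝟙 (ModuleCat.of R A))) (add_zero i) = 0 := by
    rw [this, Ext.mk₀_zero, Ext.comp_zero]
  rw [Ext.comp_mk₀_id] at h2
  rw [h2, Ext.comp_zero]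

theorem VM.of_injective (E : Type u) [AddCommGroup E] [Module R E] [Small.{u} R]
    (hE : Module.Injective R E) : VM a (i+1) E := by
  intro t e
  have := hE
  have : Injective (ModuleCat.of R E) := Module.injective_object_of_injective_module R E
  exact ⟨t, le_rfl, by rw [Ext.eq_zero_of_injective e, Ext.comp_zero]⟩

/-- degree zero -/
theorem VM.zero_iff : VM a 0 A ↔ ∀ (n : A) (t : ℕ), (∀ r ∈ a ^ t, r • n = 0) → n = 0 := by
  constructor
  · intro H n t hn
    let φ : (R ⧸ a^t) →ₗ[R] A := Submodule.liftQ _ (LinearMap.toSpanSingleton R A n)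
      (by intro r hr; simpa using hn r hr)
    obtain ⟨s, h, hs⟩ := H t (Ext.mk₀ (ModuleCat.ofHom φ))
    rw [Ext.mk₀_comp_mk₀, ← Ext.mk₀_zero] at hs
    have h1 := Ext.homEquiv₀.symm.injective hs
    have h2 := congrArg (fun z => z.hom (Submodule.Quotient.mk 1)) h1
    have h3 : φ (Submodule.Quotient.mk 1) = 0 := h2
    have h4 : LinearMap.toSpanSingleton R A n 1 = 0 := h3
    simpa using h4
  · intro H t e
    obtain ⟨f, rfl⟩ := Ext.homEquiv₀.symm.surjective e
    refine ⟨t, le_rfl, ?_⟩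
    have : f = 0 := by
      ext
      have := H (f.hom (Submodule.Quotient.mk 1)) t ?_
      · exact this
      · intro r hr
        rw [← map_smul, ← Submodule.Quotient.mk_smul]
        have : (Submodule.Quotient.mk (r • 1) : R ⧸ a^t) = 0 := by
          rw [Submodule.Quotient.mk_eq_zero]; simpa using hr
        rw [this, map_zero]
    subst this
    simp

/-- the map out of `R/a^t` given by a torsion element -/
def el (a : Ideal R) (t : ℕ) (n : A) (hn : ∀ r ∈ a ^ t, r • n = 0) :
    ModuleCat.of R (R ⧸ a^t) ⟶ ModuleCat.of R A :=
  ModuleCat.ofHom (Submodule.liftQ _ (LinearMap.toSpanSingleton R A n)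
      (by intro r hr; simpa using hn r hr))

theorem el_one (t : ℕ) (n : A) (hn : ∀ r ∈ a ^ t, r • n = 0) :
    (el a t n hn).hom (Submodule.Quotient.mk 1) = n := by
  have : LinearMap.toSpanSingleton R A n 1 = n := by simp
  exact this

theorem el_ann (t : ℕ) (f : ModuleCat.of R (R ⧸ a^t) ⟶ ModuleCat.of R A) :
    ∀ r ∈ a^t, r • f.hom (Submodule.Quotient.mk 1) = 0 := by
  intro r hr
  rw [← map_smul, ← Submodule.Quotient.mk_smul]
  have : (Submodule.Quotient.mk (r • 1) : R ⧸ a^t) = 0 := by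
    rw [Submodule.Quotient.mk_eq_zero]; simpa using hr
  rw [this, map_zero]

theorem el_ext {t : ℕ} {f g : ModuleCat.of R (R ⧸ a^t) ⟶ ModuleCat.of R A}
    (h : f.hom (Submodule.Quotient.mk 1) = g.hom (Submodule.Quotient.mk 1)) : f = g := by
  ext
  exact h

/-- degree one -/
theorem VM.one_iff {f : A →ₗ[R] B} {g : B →ₗ[R] C} (hf : Function.Injective f)
    (h : Function.Exact f g) (hg : Function.Surjective g) (hB : VM a 1 B) :
    VM a 1 A ↔ ∀ (q : C) (t : ℕ), (∀ r ∈ a ^ t, r • q = 0) →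
      ∃ (b : B) (s : ℕ), (∀ r ∈ a ^ s, r • b = 0) ∧ g b = q := by
  have hS := SC_exact hf h hg
  constructor
  · intro H q t hq
    obtain ⟨s, hts, hs⟩ := H t ((Ext.mk₀ (el a t q hq)).comp hS.extClass (zero_add 1))
    rw [← Ext.comp_assoc_of_second_deg_zero, Ext.mk₀_comp_mk₀] at hs
    obtain ⟨x, hx⟩ := Ext.covariant_sequence_exact₃ _ hS _ _ hs
    obtain ⟨x, rfl⟩ := Ext.homEquiv₀.symm.surjective x
    refine ⟨x.hom (Submodule.Quotient.mk 1), s, el_ann s x, ?_⟩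
    have hx' : Ext.mk₀ (x ≫ ModuleCat.ofHom g) = Ext.mk₀ (proj a hts ≫ el a t q hq) := by
      rw [← Ext.mk₀_comp_mk₀]; exact hx
    have h1 := Ext.homEquiv₀.symm.injective hx'
    have h2 := congrArg (fun z => z.hom (Submodule.Quotient.mk 1)) h1
    exact h2.trans (el_one t q hq)
  · intro H t e
    obtain ⟨s, hts, hs⟩ := hB t (e.comp (Ext.mk₀ (ModuleCat.ofHom f)) (add_zero _))
    obtain ⟨x, hx⟩ := Ext.covariant_sequence_exact₁ _ hS ((Ext.mk₀ (proj a hts)).comp e (zero_add _)) 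
      (by rw [← hs, Ext.comp_assoc_of_third_deg_zero]) (zero_add 1)
    obtain ⟨x, rfl⟩ := Ext.homEquiv₀.symm.surjective x
    obtain ⟨b, r, hb, hbq⟩ := H (x.hom (Submodule.Quotient.mk 1)) s (el_ann s x)
    have hb' : ∀ p ∈ a ^ (max r s), p • b = 0 := 
      fun p hp => hb p (Ideal.pow_le_pow_right (le_max_left _ _) hp)
    refine ⟨max r s, hts.trans (le_max_right _ _), ?_⟩
    rw [← V_mono_elt hts (le_max_right r s), ← hx, ← Ext.comp_assoc_of_second_deg_zero]
    have h3 : proj a (le_max_right r s) ≫ x = el a (max r s) b hb' ≫ ModuleCat.ofHom g := by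
      apply el_ext
      refine Eq.trans ?_ ((congrArg g (el_one _ b hb')).trans hbq).symm
      rfl
    change Ext.comp (Ext.comp (Ext.mk₀ _) (Ext.mk₀ x) _) _ _ = 0
    rw [Ext.mk₀_comp_mk₀, h3, ← Ext.mk₀_comp_mk₀, Ext.comp_assoc_of_second_deg_zero]
    rw [hS.comp_extClass, Ext.comp_zero]

theorem VM.shift_iff {f : A →ₗ[R] B} {g : B →ₗ[R] C} (hf : Function.Injective f)
    (h : Function.Exact f g) (hg : Function.Surjective g) (hB : ∀ i, VM a (i+1) B) :
    VM a (i+2) A ↔ VM a (i+1) C :=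
  ⟨fun H => VM.right hf h hg (hB _) H, fun H => VM.left hf h hg (hB _) H⟩

end
end CDB

namespace CDB
open Abelian
variable {R : Type u} [CommRing R]

section
variable {N : Type u} [AddCommGroup N] [Module R N]

theorem VM.of_bijective {a : Ideal R} {i : ℕ} {x : R} (hx : x ∈ a)
    (hb : Function.Bijective (fun n : N => x • n)) : VM a i N := by
  intro t e
  refine ⟨t, le_rfl, ?_⟩
  have hb' : Function.Bijective (LinearMap.lsmul R N (x^t)) := by
    have h1 : ∀ k : ℕ, Function.Bijective (fun n : N => x^k • n) := by
      intro k
      induction k with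
      | zero => simp only [pow_zero, one_smul]; exact Function.bijective_id
      | succ k ih =>
        have := ih.comp hb
        simpa [Function.comp_def, pow_succ, mul_smul] using this
    exact h1 t
  let φ := LinearEquiv.ofBijective _ hb'
  have h0 : e.comp (Ext.mk₀ (ModuleCat.ofHom φ.toLinearMap)) (add_zero i) = 0 := by
    have h1 : ModuleCat.ofHom φ.toLinearMap = x^t • 𝟙 (ModuleCat.of R N) := by
      ext; rfl
    rw [h1, Ext.mk₀_smul, Ext.comp_smul, Ext.comp_mk₀_id]
    have h2 : x^t • 𝟙 (ModuleCat.of R (R ⧸ a^t)) = 0 := by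
      apply el_ext
      have : (Submodule.Quotient.mk (x^t • 1) : R ⧸ a^t) = 0 := by
        rw [Submodule.Quotient.mk_eq_zero]; simpa using Ideal.pow_mem_pow hx t
      exact this
    rw [← Ext.mk₀_id_comp e, ← Ext.smul_comp, ← Ext.mk₀_smul, h2, Ext.mk₀_zero, Ext.zero_comp]
  have h1 : ModuleCat.ofHom φ.toLinearMap ≫ ModuleCat.ofHom φ.symm.toLinearMap = 𝟙 _ := by
    ext n; exact φ.symm_apply_apply n
  have h2 := congrArg (fun z => z.comp (Ext.mk₀ (ModuleCat.ofHom φ.symm.toLinearMap)) (add_zero _)) h0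
  simp only [Ext.comp_assoc_of_third_deg_zero, Ext.mk₀_comp_mk₀, h1, Ext.zero_comp, Ext.comp_mk₀_id] at h2
  rw [h2, Ext.comp_zero]

/-- x-power torsion -/
def gam (x : R) (N : Type u) [AddCommGroup N] [Module R N] : Submodule R N where
  carrier := {n | ∃ k : ℕ, x ^ k • n = 0}
  zero_mem' := ⟨0, by simp⟩
  add_mem' := by
    rintro a b ⟨k, hk⟩ ⟨l, hl⟩
    refine ⟨k + l, ?_⟩
    rw [smul_add, pow_add, mul_smul, mul_smul, hl, smul_comm, hk]
    simp
  smul_mem' := by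
    rintro r a ⟨k, hk⟩
    exact ⟨k, by rw [smul_comm, hk, smul_zero]⟩

theorem mem_gam {x : R} {n : N} : n ∈ gam x N ↔ ∃ k : ℕ, x ^ k • n = 0 := Iff.rfl

theorem gam_injective [IsNoetherianRing R] (x : R) (hN : Module.Injective R N) :
    Module.Injective R (gam x N) := by
  apply Module.Baer.injective
  intro I g
  obtain ⟨S, hS⟩ := (isNoetherianRing_iff_ideal_fg R).1 inferInstance I
  -- a uniform exponent
  have h1 : ∃ k : ℕ, ∀ y : I, x ^ k • g y = 0 := by
    have : ∀ J : Ideal R, J.FG → ∀ hJ : J ≤ I, ∃ k : ℕ, ∀ y (hy : y ∈ J), x ^ k • g ⟨y, hJ hy⟩ = 0 := by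
      intro J hJ
      induction J, hJ using Submodule.fg_induction with
      | singleton z =>
        intro hJ
        have hz : z ∈ I := hJ (Submodule.mem_span_singleton_self z)
        obtain ⟨k, hk⟩ := (g ⟨z, hz⟩).2
        refine ⟨k, fun y hy => ?_⟩
        obtain ⟨r, rfl⟩ := Submodule.mem_span_singleton.1 hy
        have : g ⟨r • z, hJ hy⟩ = r • g ⟨z, hz⟩ := by rw [← map_smul]; rfl
        rw [this, smul_comm]
        have : x ^ k • g ⟨z, hz⟩ = 0 := Subtype.ext hk
        rw [this, smul_zero]
      | sup A B hA hB ihA ihB =>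
        intro hJ
        obtain ⟨k, hk⟩ := ihA (le_sup_left.trans hJ)
        obtain ⟨l, hl⟩ := ihB (le_sup_right.trans hJ)
        refine ⟨k + l, fun y hy => ?_⟩
        obtain ⟨p, hp, q, hq, rfl⟩ := Submodule.mem_sup.1 hy
        have : g ⟨p + q, hJ hy⟩ = g ⟨p, hJ (le_sup_left (a := A) hp)⟩ +
            g ⟨q, hJ (le_sup_right (a := A) hq)⟩ := by rw [← map_add]; rfl
        rw [this, smul_add, pow_add, mul_smul, mul_smul, hl q hq, smul_comm, hk p hp]
        simp
    obtain ⟨k, hk⟩ := this I ⟨S, hS⟩ le_rfl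
    exact ⟨k, fun y => hk y.1 y.2⟩
  obtain ⟨k, hk⟩ := h1
  obtain ⟨k0, hAR⟩ := Ideal.exists_pow_inf_eq_pow_smul (Ideal.span {x}) (M := R) I
  set n := k0 + k
  let ρ : I →ₗ[R] (R ⧸ Ideal.span {x ^ n}) := (Submodule.mkQ _).comp I.subtype
  have hker : LinearMap.ker ρ ≤ LinearMap.ker ((gam x N).subtype.comp g) := by
    intro y hy
    have hy1 : (y : R) ∈ Ideal.span {x ^ n} := by
      have : ρ y = 0 := hy
      rwa [LinearMap.comp_apply, Submodule.mkQ_apply, Submodule.Quotient.mk_eq_zero] at this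
    have hy2 : (y : R) ∈ Ideal.span {x} ^ n • (⊤ : Ideal R) ⊓ I := by
      refine ⟨?_, y.2⟩
      rw [Ideal.span_singleton_pow]
      simpa using hy1
    rw [hAR n (by omega)] at hy2
    have hy3 : (y : R) ∈ Ideal.span {x ^ k} • I := by
      have : n - k0 = k := by omega
      rw [this, Ideal.span_singleton_pow] at hy2
      exact Submodule.smul_mono le_rfl inf_le_right hy2
    obtain ⟨w, hw, hwy⟩ := Ideal.mem_span_singleton_mul.1 hy3
    have : y = x ^ k • (⟨w, hw⟩ : I) := Subtype.ext hwy.symm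
    rw [LinearMap.mem_ker, LinearMap.comp_apply, this, map_smul, hk, map_zero]
  let g1 : (I ⧸ LinearMap.ker ρ) →ₗ[R] N := Submodule.liftQ _ ((gam x N).subtype.comp g) hker
  let ρ1 : (I ⧸ LinearMap.ker ρ) →ₗ[R] (R ⧸ Ideal.span {x ^ n}) := Submodule.liftQ _ ρ le_rfl
  obtain ⟨h, hh⟩ := hN.out ρ1 (LinearMap.ker_eq_bot.1 (Submodule.ker_liftQ_eq_bot _ _ _ le_rfl)) g1
  let h2 : R →ₗ[R] N := h.comp (Submodule.mkQ _)
  have hmem : ∀ r, h2 r ∈ gam x N := by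
    intro r
    refine ⟨n, ?_⟩
    rw [← map_smul]
    have : Submodule.mkQ (Ideal.span {x^n}) (x ^ n • r) = 0 := by
      rw [Submodule.mkQ_apply, Submodule.Quotient.mk_eq_zero]
      exact Ideal.mul_mem_right _ _ (Ideal.mem_span_singleton_self _)
    rw [LinearMap.comp_apply, this, map_zero]
  refine ⟨h2.codRestrict _ hmem, fun y hy => Subtype.ext ?_⟩
  exact hh (Submodule.Quotient.mk ⟨y, hy⟩)

theorem gam_quot_bijective [IsNoetherianRing R] (x : R) (hN : Module.Injective R N) :
    Function.Bijective (fun c : N ⧸ gam x N => x • c) := by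
  constructor
  · rw [show (fun c : N ⧸ gam x N => x • c) = LinearMap.lsmul R (N ⧸ gam x N) x from rfl]
    rw [injective_iff_map_eq_zero]
    intro c hc
    obtain ⟨n, rfl⟩ := Submodule.Quotient.mk_surjective _ c
    have hc' : x • n ∈ gam x N := (Submodule.Quotient.mk_eq_zero _).1 hc
    obtain ⟨k, hk⟩ := hc'
    rw [Submodule.Quotient.mk_eq_zero]
    exact ⟨k+1, by rw [pow_succ, mul_smul, hk]⟩
  · intro c
    obtain ⟨j, rfl⟩ := Submodule.Quotient.mk_surjective _ c
    let F : ℕ →o Submodule R R := ⟨fun k => LinearMap.ker (LinearMap.lsmul R R (x^k)), by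
      intro k l hkl r hr
      obtain ⟨m, rfl⟩ := Nat.exists_eq_add_of_le' hkl
      have : x^k * r = 0 := hr
      change x^(m+k) * r = 0
      rw [pow_add, mul_assoc, this, mul_zero]⟩
    obtain ⟨k, hk⟩ := monotone_stabilizes_iff_noetherian.2 (inferInstance : IsNoetherian R R) F
    have hk' : ∀ r, x^(k+1) * r = 0 → x^k * r = 0 := by
      intro r hr
      have h1 : r ∈ F (k+1) := hr
      rw [← hk (k+1) (by omega)] at h1
      exact h1
    let p : R →ₗ[R] R := LinearMap.lsmul R R (x^(k+1))
    let q : R →ₗ[R] N := LinearMap.toSpanSingleton R N (x^k • j)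
    have hpq : LinearMap.ker p ≤ LinearMap.ker q := by
      intro r hr
      have := hk' r hr
      change r • (x^k • j) = 0
      rw [smul_smul, mul_comm, this, zero_smul]
    obtain ⟨h, hh⟩ := hN.out (Submodule.liftQ _ p le_rfl) 
      (LinearMap.ker_eq_bot.1 (Submodule.ker_liftQ_eq_bot _ _ _ le_rfl)) (Submodule.liftQ _ q hpq)
    have h1 : h (x^(k+1) * 1) = (1:R) • (x^k • j) := hh (Submodule.Quotient.mk 1)
    refine ⟨Submodule.Quotient.mk (h 1), ?_⟩
    change Submodule.Quotient.mk (x • h 1) = _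
    rw [Submodule.Quotient.eq]
    refine ⟨k, ?_⟩
    rw [smul_sub, smul_smul, ← pow_succ, ← map_smul, smul_eq_mul, h1]
    simp

theorem exists_inj (N : Type u) [AddCommGroup N] [Module R N] :
    ∃ (E : Type u) (_ : AddCommGroup E) (_ : Module R E) (f : N →ₗ[R] E),
      Function.Injective f ∧ Module.Injective R E := by
  let I := Injective.under (ModuleCat.of R N)
  refine ⟨I, inferInstance, inferInstance, (Injective.ι (ModuleCat.of R N)).hom, 
    (ModuleCat.mono_iff_injective _).1 inferInstance, ?_⟩
  have : Injective (ModuleCat.of R I) := inferInstanceAs (Injective I)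
  exact Module.injective_module_of_injective_object R I

end
end CDB

namespace CDB
open Abelian
variable {R : Type u} [CommRing R]

theorem VM.bot (N : Type u) [AddCommGroup N] [Module R N] (i : ℕ) :
    VM (⊥ : Ideal R) (i+1) N := by
  intro t e
  refine ⟨t+1, by omega, ?_⟩
  have h0 : (⊥ : Ideal R)^(t+1) = ⊥ := by rw [pow_succ]; simp
  have : Module.Projective R (R ⧸ (⊥ : Ideal R)^(t+1)) :=
    Module.Projective.of_equiv (Submodule.quotEquivOfEqBot _ h0).symm
  have : Projective (ModuleCat.of R (R ⧸ (⊥ : Ideal R)^(t+1))) :=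
    (IsProjective.iff_projective _).1 this
  exact Ext.eq_zero_of_projective _

theorem exact_mkQ {N E : Type u} [AddCommGroup N] [Module R N] [AddCommGroup E] [Module R E]
    (f : N →ₗ[R] E) : Function.Exact f (LinearMap.range f).mkQ := by
  rw [LinearMap.exact_iff]; simp

theorem tors_sup {N : Type u} [AddCommGroup N] [Module R N] {a : Ideal R} {x : R} {n : N} {s k : ℕ}
    (h : ∀ r ∈ a^s, r • n = 0) (hk : x^k • n = 0) :
    ∀ r ∈ (a ⊔ Ideal.span {x})^(s+k), r • n = 0 := by
  intro r hr
  have := Ideal.sup_pow_add_le_pow_sup_pow hr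
  rw [Ideal.span_singleton_pow] at this
  obtain ⟨p, hp, q, hq, rfl⟩ := Submodule.mem_sup.1 this
  obtain ⟨c, rfl⟩ := Ideal.mem_span_singleton'.1 hq
  rw [add_smul, h p hp, mul_smul, hk, smul_zero, zero_add]

theorem VM.sup [IsNoetherianRing R] {a : Ideal R} {x : R} {i : ℕ} :
    ∀ {K : Type u} [AddCommGroup K] [Module R K], (∀ n : K, ∃ k : ℕ, x^k • n = 0) →
      VM a i K → VM (a ⊔ Ideal.span {x}) i K := by
  induction i with
  | zero =>
    intro K _ _ hK H
    rw [VM.zero_iff] at H ⊢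
    intro n t hn
    exact H n t fun r hr => hn r (Ideal.pow_right_mono le_sup_left t hr)
  | succ i ih =>
    intro K _ _ hK H
    obtain ⟨E, _, _, f, hf, hE⟩ := exists_inj (R := R) K
    have hG := gam_injective x hE
    let f' : K →ₗ[R] gam x E := f.codRestrict _ (fun n => by
      obtain ⟨k, hk⟩ := hK n
      exact ⟨k, by rw [← map_smul, hk, map_zero]⟩)
    have hf' : Function.Injective f' := fun p q hpq => hf (congrArg Subtype.val hpq)
    have hG' : ∀ e : gam x E, ∃ k : ℕ, x^k • e = 0 := by
      rintro ⟨e, k, hk⟩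
      exact ⟨k, Subtype.ext hk⟩
    cases i with
    | zero =>
      rw [zero_add, VM.one_iff hf' (exact_mkQ f') (Submodule.mkQ_surjective _) (VM.of_injective _ hG)] at H ⊢
      intro q t hq
      obtain ⟨b, s, hb, hbq⟩ := H q t fun r hr => hq r (Ideal.pow_right_mono le_sup_left t hr)
      obtain ⟨k, hk⟩ := hG' b
      exact ⟨b, s + k, tors_sup hb hk, hbq⟩
    | succ i =>
      rw [VM.shift_iff hf' (exact_mkQ f') (Submodule.mkQ_surjective _) (fun _ => VM.of_injective _ hG)] at H ⊢
      refine ih ?_ H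
      intro q
      obtain ⟨e, rfl⟩ := Submodule.mkQ_surjective _ q
      obtain ⟨k, hk⟩ := hG' e
      exact ⟨k, by rw [← map_smul, hk, map_zero]⟩

section
variable {T : Type u} [CommRing T] [Algebra R T]

theorem VM.of_injective_tower [IsNoetherianRing R] [IsNoetherianRing T] (s : Finset R) :
    ∀ {J : Type u} [AddCommGroup J] [Module R J] [Module T J] [IsScalarTower R T J],
      Module.Injective T J → ∀ i, VM (Ideal.span (s : Set R)) (i+1) J := by
  classical
  induction s using Finset.induction_on with
  | empty =>
    intro J _ _ _ _ hJ i
    simpa using VM.bot J i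
  | insert x s hx ih =>
    intro J _ _ _ _ hJ i
    let y := algebraMap R T x
    have hy : ∀ (k : ℕ) (j : J), y^k • j = x^k • j := by
      intro k j
      rw [← map_pow, algebraMap_smul]
    let G := gam y J
    let f : G →ₗ[R] J := G.subtype.restrictScalars R
    let g : J →ₗ[R] (J ⧸ G) := G.mkQ.restrictScalars R
    have hfg : Function.Exact f g := LinearMap.exact_subtype_mkQ G
    have hI : Ideal.span ((insert x s : Finset R) : Set R) = Ideal.span (s : Set R) ⊔ Ideal.span {x} := by
      rw [Finset.coe_insert, Ideal.span_insert, sup_comm]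
    refine VM.mid (f := f) (g := g) G.injective_subtype hfg G.mkQ_surjective ?_ ?_
    · rw [hI]
      refine VM.sup ?_ (ih (gam_injective y hJ) i)
      rintro ⟨n, k, hk⟩
      exact ⟨k, Subtype.ext ((hy k n).symm.trans hk)⟩
    · refine VM.of_bijective (x := x) (Ideal.subset_span (by simp)) ?_
      have h2 := gam_quot_bijective y hJ
      have : (fun c : J ⧸ gam y J => y • c) = fun c => x • c := by
        ext c
        rw [algebraMap_smul]
      rwa [this] at h2

theorem tors_tower {N : Type u} [AddCommGroup N] [Module R N] [Module T N] [IsScalarTower R T N]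
    (a : Ideal R) (t : ℕ) (n : N) :
    (∀ r ∈ (a.map (algebraMap R T))^t, r • n = 0) ↔ ∀ r ∈ a^t, r • n = 0 := by
  rw [← Ideal.map_pow]
  have : (∀ r ∈ (a^t).map (algebraMap R T), r • n = 0) ↔
      (a^t).map (algebraMap R T) ≤ LinearMap.ker (LinearMap.toSpanSingleton T N n) := Iff.rfl
  rw [this]
  refine Ideal.map_le_iff_le_comap.trans ?_
  refine forall_congr' fun r => forall_congr' fun _ => ?_
  rw [Ideal.mem_comap]
  change algebraMap R T r • n = 0 ↔ _
  rw [algebraMap_smul]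

/-- independence of base -/
theorem VM.tower_iff [IsNoetherianRing R] [IsNoetherianRing T] (a : Ideal R) (i : ℕ) :
    ∀ {N : Type u} [AddCommGroup N] [Module R N] [Module T N] [IsScalarTower R T N],
    VM a i N ↔ VM (a.map (algebraMap R T)) i N := by
  induction i with
  | zero =>
    intro N _ _ _ _
    simp only [VM.zero_iff, tors_tower]
  | succ i ih =>
    intro N _ _ _ _
    obtain ⟨E, _, _, f, hf, hE⟩ := exists_inj (R := T) N
    let _ : Module R E := Module.compHom E (algebraMap R T)
    have : IsScalarTower R T E := IsScalarTower.of_algebraMap_smul fun r n => rfl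
    let f' := f.restrictScalars R
    let g' : E →ₗ[R] (E ⧸ LinearMap.range f) := (LinearMap.range f).mkQ.restrictScalars R
    have he : Function.Exact f' g' := by
      intro y
      have h0 := exact_mkQ (R := T) f y
      exact h0
    have hf' : Function.Injective f' := fun p q hpq => hf hpq
    have hg' : Function.Surjective g' := fun q => Submodule.mkQ_surjective _ q
    have hE1 : ∀ i, VM a (i+1) E := by
      obtain ⟨S, rfl⟩ := (isNoetherianRing_iff_ideal_fg R).1 inferInstance a
      exact VM.of_injective_tower S hE
    cases i with
    | zero =>
      rw [zero_add, VM.one_iff hf (exact_mkQ f) (Submodule.mkQ_surjective _) (VM.of_injective _ hE),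
        VM.one_iff hf' he hg' (hE1 0)]
      simp only [tors_tower]
      rfl
    | succ i =>
      rw [VM.shift_iff hf (exact_mkQ f) (Submodule.mkQ_surjective _) (fun _ => VM.of_injective _ hE),
        VM.shift_iff hf' he hg' hE1]
      exact ih
end
end CDB

namespace CDB
open Abelian
variable {R : Type u} [CommRing R]

theorem VM.of_sub {N : Type u} [AddCommGroup N] [Module R N] {a : Ideal R} {i : ℕ}
    (W : Submodule R N) (h1 : VM a i W) (h2 : VM a i (N ⧸ W)) : VM a i N :=
  VM.mid W.injective_subtype (LinearMap.exact_subtype_mkQ W) W.mkQ_surjective h1 h2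

theorem VM.quot {X N : Type u} [AddCommGroup N] [Module R N] [AddCommGroup X] [Module R X]
    {a : Ideal R} {i : ℕ}
    (f : X →ₗ[R] N) (hf : Function.Surjective f) (h1 : VM a i X)
    (h2 : VM a (i+1) (LinearMap.ker f)) : VM a i N :=
  VM.right (LinearMap.ker f).injective_subtype (LinearMap.exact_subtype_ker_map f) hf h1 h2

/-- finiteness of cohomological dimension -/
theorem VM.of_card_lt [IsNoetherianRing R] (s : Finset R) :
    ∀ (N : Type u) [AddCommGroup N] [Module R N] (i : ℕ), s.card < i →
      VM (Ideal.span (s : Set R)) i N := by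
  classical
  induction s using Finset.induction_on with
  | empty =>
    intro N _ _ i hi
    obtain ⟨i, rfl⟩ := Nat.exists_eq_succ_of_ne_zero (n := i) (by simp at hi; omega)
    simpa using VM.bot N i
  | insert x s hx ih =>
    intro N _ _ i hi
    rw [Finset.card_insert_of_notMem hx] at hi
    have hI : Ideal.span ((insert x s : Finset R) : Set R) = Ideal.span (s : Set R) ⊔ Ideal.span {x} := by
      rw [Finset.coe_insert, Ideal.span_insert, sup_comm]
    have hxm : x ∈ Ideal.span ((insert x s : Finset R) : Set R) := Ideal.subset_span (by simp)
    have key : ∀ (K : Type u) [AddCommGroup K] [Module R K], (∀ n : K, ∃ k : ℕ, x^k • n = 0) →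
        ∀ j, s.card < j → VM (Ideal.span ((insert x s : Finset R) : Set R)) j K := by
      intro K _ _ hK j hj
      rw [hI]
      exact VM.sup hK (ih K j hj)
    let S := Submonoid.powers x
    let f : N →ₗ[R] LocalizedModule S N := LocalizedModule.mkLinearMap S N
    obtain ⟨j, rfl⟩ := Nat.exists_eq_succ_of_ne_zero (n := i) (by omega)
    have hr : VM (Ideal.span ((insert x s : Finset R) : Set R)) (j+1) (LinearMap.range f) := by
      refine VM.left (LinearMap.range f).injective_subtype (LinearMap.exact_subtype_mkQ _)
        (Submodule.mkQ_surjective _) ?_ (key _ ?_ j (by omega))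
      · refine VM.of_bijective hxm ?_
        have := IsLocalizedModule.map_units f (⟨x, Submonoid.mem_powers x⟩ : S)
        rw [Module.End.isUnit_iff] at this
        exact this
      · intro q
        obtain ⟨y, rfl⟩ := Submodule.mkQ_surjective _ q
        obtain ⟨⟨n, ⟨_, k, rfl⟩⟩, hn⟩ := IsLocalizedModule.surj S f y
        refine ⟨k, ?_⟩
        rw [← map_smul]
        have : x^k • y ∈ LinearMap.range f := ⟨n, hn.symm⟩
        rwa [Submodule.mkQ_apply, Submodule.Quotient.mk_eq_zero]
    refine VM.mid (LinearMap.ker f).injective_subtype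
      (g := f.rangeRestrict) ?_ f.surjective_rangeRestrict (key _ ?_ _ (by omega)) hr
    · rw [LinearMap.exact_iff]; simp
    · rintro ⟨n, hn⟩
      obtain ⟨⟨_, k, rfl⟩, hc⟩ := (IsLocalizedModule.eq_zero_iff S f).1 hn
      exact ⟨k, Subtype.ext hc⟩

theorem finsupp_injective [IsNoetherianRing R] (ι : Type u) {E : Type u} [AddCommGroup E] [Module R E]
    (hE : Module.Injective R E) : Module.Injective R (ι →₀ E) := by
  classical
  apply Module.Baer.injective
  intro I g
  obtain ⟨S, hS⟩ := (isNoetherianRing_iff_ideal_fg R).1 inferInstance I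
  have h1 : ∃ F : Finset ι, ∀ y : I, g y ∈ Finsupp.supported E R (F : Set ι) := by
    have : ∀ J : Ideal R, J.FG → ∀ hJ : J ≤ I, ∃ F : Finset ι, ∀ y (hy : y ∈ J),
        g ⟨y, hJ hy⟩ ∈ Finsupp.supported E R (F : Set ι) := by
      intro J hJ
      induction J, hJ using Submodule.fg_induction with
      | singleton z =>
        intro hJ
        have hz : z ∈ I := hJ (Submodule.mem_span_singleton_self z)
        refine ⟨(g ⟨z, hz⟩).support, fun y hy => ?_⟩
        obtain ⟨r, rfl⟩ := Submodule.mem_span_singleton.1 hy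
        have : g ⟨r • z, hJ hy⟩ = r • g ⟨z, hz⟩ := by rw [← map_smul]; rfl
        rw [this]
        apply Submodule.smul_mem
        rw [Finsupp.mem_supported]
      | sup A B hA hB ihA ihB =>
        intro hJ
        obtain ⟨k, hk⟩ := ihA (le_sup_left.trans hJ)
        obtain ⟨l, hl⟩ := ihB (le_sup_right.trans hJ)
        refine ⟨k ∪ l, fun y hy => ?_⟩
        obtain ⟨p, hp, q, hq, rfl⟩ := Submodule.mem_sup.1 hy
        have : g ⟨p + q, hJ hy⟩ = g ⟨p, hJ (le_sup_left (a := A) hp)⟩ +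
            g ⟨q, hJ (le_sup_right (a := A) hq)⟩ := by rw [← map_add]; rfl
        rw [this]
        refine Submodule.add_mem _ (Finsupp.supported_mono ?_ (hk p hp)) (Finsupp.supported_mono ?_ (hl q hq))
        · simp
        · simp
    obtain ⟨k, hk⟩ := this I ⟨S, hS⟩ le_rfl
    exact ⟨k, fun y => hk y.1 y.2⟩
  obtain ⟨F, hF⟩ := h1
  have hB := Module.Baer.of_injective hE
  choose h hh using fun i : ι => hB I ((Finsupp.lapply i).comp g)
  refine ⟨∑ i ∈ F, (Finsupp.lsingle i).comp (h i), fun y hy => ?_⟩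
  ext j
  simp only [LinearMap.sum_apply, LinearMap.comp_apply, Finsupp.lsingle_apply, Finsupp.finsetSum_apply,
    hh _ y hy, Finsupp.lapply_apply, Finsupp.single_apply, Finset.sum_ite_eq']
  split_ifs with hj
  · rfl
  · have := hF ⟨y, hy⟩
    rw [Finsupp.mem_supported'] at this
    exact (this j hj).symm

theorem VM.finsupp [IsNoetherianRing R] (ι : Type u) {a : Ideal R} {i : ℕ} :
    ∀ {N : Type u} [AddCommGroup N] [Module R N], VM a i N → VM a i (ι →₀ N) := by
  classical
  induction i with
  | zero =>
    intro N _ _ H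
    rw [VM.zero_iff] at H ⊢
    intro n t hn
    ext j
    exact H (n j) t fun r hr => DFunLike.congr_fun (hn r hr) j
  | succ i ih =>
    intro N _ _ H
    obtain ⟨E, _, _, f, hf, hE⟩ := exists_inj (R := R) N
    have hE' := finsupp_injective ι hE
    let g := (LinearMap.range f).mkQ
    have hg : Function.Surjective g := Submodule.mkQ_surjective _
    have hfg : Function.Exact f g := exact_mkQ f
    let f' : (ι →₀ N) →ₗ[R] (ι →₀ E) := Finsupp.mapRange.linearMap f
    let g' : (ι →₀ E) →ₗ[R] (ι →₀ (E ⧸ LinearMap.range f)) := Finsupp.mapRange.linearMap g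
    have hf' : Function.Injective f' := Finsupp.mapRange_injective f (map_zero f) hf
    have hg' : Function.Surjective g' := Finsupp.mapRange_surjective g (map_zero g) hg
    have hfg' : Function.Exact f' g' := by
      intro y
      constructor
      · intro hy
        have h1 : ∀ j, ∃ n, f n = y j := fun j => (hfg (y j)).1 (DFunLike.congr_fun hy j)
        choose n hn using h1
        refine ⟨Finsupp.onFinset y.support n (fun j hj => ?_), ?_⟩
        · rw [Finsupp.mem_support_iff]
          intro h0
          exact hj (hf (by rw [hn, h0, map_zero]))
        · ext j
          exact hn j
      · rintro ⟨n, rfl⟩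
        ext j
        exact hfg.apply_apply_eq_zero (n j)
    cases i with
    | zero =>
      rw [zero_add, VM.one_iff hf hfg hg (VM.of_injective _ hE)] at H
      rw [zero_add, VM.one_iff hf' hfg' hg' (VM.of_injective _ hE')]
      intro q t hq
      choose b s hb hbq using fun j => H (q j) t fun r hr => DFunLike.congr_fun (hq r hr) j
      refine ⟨∑ j ∈ q.support, Finsupp.single j (b j), q.support.sup s, ?_, ?_⟩
      · intro r hr
        rw [Finset.smul_sum]
        refine Finset.sum_eq_zero fun j hj => ?_
        rw [Finsupp.smul_single, hb j r (Ideal.pow_le_pow_right (Finset.le_sup hj) hr), Finsupp.single_zero]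
      · rw [map_sum]
        conv_rhs => rw [← Finsupp.sum_single q]
        refine Finset.sum_congr rfl fun j hj => ?_
        change Finsupp.mapRange g (map_zero g) _ = _
        rw [Finsupp.mapRange_single, hbq]
    | succ i =>
      rw [VM.shift_iff hf hfg hg (fun _ => VM.of_injective _ hE)] at H
      rw [VM.shift_iff hf' hfg' hg' (fun _ => VM.of_injective _ hE')]
      exact ih H

end CDB

namespace CDB
open Abelian
variable {R : Type u} [CommRing R]

theorem exists_ne_zero_of_not_torsion {D : Type u} [CommRing D] [IsDomain D] [IsNoetherianRing D]
    (M : Type u) [AddCommGroup M] [Module D M] [Module.Finite D M] (h : ¬ Module.IsTorsion D M) :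
    ∃ φ : M →ₗ[D] D, φ ≠ 0 := by
  let k := FractionRing D
  let S := nonZeroDivisors D
  let ι : M →ₗ[D] k ⊗[D] M := TensorProduct.mk D k M 1
  have : IsLocalizedModule S ι := 
    (isLocalizedModule_iff_isBaseChange S k ι).2 (TensorProduct.isBaseChange D M k)
  have h1 : ∃ m, ι m ≠ 0 := by
    by_contra! hc
    apply h
    intro m
    exact (IsLocalizedModule.eq_zero_iff S ι).1 (hc m)
  obtain ⟨m, hm⟩ := h1
  have h2 := (Module.forall_dual_apply_eq_zero_iff k (ι m)).not.2 hm
  push Not at h2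
  obtain ⟨φ, hφ⟩ := h2
  have hfp : Module.FinitePresentation D M := Module.finitePresentation_of_finite D M
  obtain ⟨h, s, hs⟩ := Module.FinitePresentation.exists_lift_of_isLocalizedModule S
    (Algebra.linearMap D k) ((φ.restrictScalars D).comp ι)
  refine ⟨h, ?_⟩
  rintro rfl
  have h3 := LinearMap.congr_fun hs m
  have h4 : (0 : k) = (s : D) • φ (ι m) := by
    simp only [LinearMap.comp_zero, LinearMap.zero_apply] at h3
    exact h3
  rw [Algebra.smul_def] at h4
  rcases mul_eq_zero.1 h4.symm with h5 | h5
  · exact nonZeroDivisors.ne_zero s.2 ((FaithfulSMul.algebraMap_eq_zero_iff D k).1 h5)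
  · exact hφ h5

theorem not_torsion_quot (M : Type u) [AddCommGroup M] [Module R M]
    [Module.Finite R M] (p : Ideal R) (hp : p.IsPrime) (h : Module.annihilator R M ≤ p)
    (hfin : Module.Finite (R ⧸ p) (M ⧸ (p • ⊤ : Submodule R M))) :
    ¬ Module.IsTorsion (R ⧸ p) (M ⧸ (p • ⊤ : Submodule R M)) := by
  intro ht
  obtain ⟨d, hd1, hd2⟩ := Submodule.annihilator_top_inter_nonZeroDivisors ht
  obtain ⟨s, rfl⟩ := Ideal.Quotient.mk_surjective d
  have hs : s ∉ p := by
    intro hs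
    have : Nontrivial (R ⧸ p) := Ideal.Quotient.nontrivial_iff.2 hp.ne_top
    exact nonZeroDivisors.ne_zero hd2 (Ideal.Quotient.eq_zero_iff_mem.2 hs)
  have hsM : ∀ m : M, s • m ∈ (p • ⊤ : Submodule R M) := by
    intro m
    have := (Submodule.mem_annihilator).1 hd1 (Submodule.Quotient.mk m) trivial
    rw [← Submodule.Quotient.mk_eq_zero]
    exact this
  obtain ⟨q, hq, hdeg, hc, h0⟩ := LinearMap.exists_monic_and_natDegree_eq_and_coeff_mem_pow_and_aeval_eq_zero
    R (algebraMap R (Module.End R M) s) p (by rintro _ ⟨m, rfl⟩; exact hsM m)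
  have h1 : q.eval s ∈ p := by
    apply h
    rw [Module.mem_annihilator]
    intro m
    have := LinearMap.congr_fun h0 m
    rw [Polynomial.aeval_algebraMap_apply] at this
    simpa using this
  rw [Polynomial.eval_eq_sum_range, Finset.sum_range_succ, hq.coeff_natDegree, one_mul] at h1
  have h2 : ∑ x ∈ Finset.range q.natDegree, q.coeff x * s ^ x ∈ p := by
    refine Ideal.sum_mem _ fun i hi => Ideal.mul_mem_right _ _ ?_
    have := hc i
    rw [Finset.mem_range] at hi
    exact Ideal.pow_le_self (by omega) this
  exact hs (hp.mem_of_pow_mem _ ((Ideal.add_mem_iff_right _ h2).1 h1))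

theorem exists_ne_zero_prime [IsNoetherianRing R] (M : Type u) [AddCommGroup M] [Module R M]
    [Module.Finite R M] (p : Ideal R) [hp : p.IsPrime] (h : Module.annihilator R M ≤ p) :
    ∃ φ : M →ₗ[R] (R ⧸ p), φ ≠ 0 := by
  have hfin : Module.Finite (R ⧸ p) (M ⧸ (p • ⊤ : Submodule R M)) :=
    Module.Finite.of_restrictScalars_finite R _ _
  obtain ⟨φ, hφ⟩ := exists_ne_zero_of_not_torsion _ (not_torsion_quot M p hp h hfin)
  refine ⟨(φ.restrictScalars R).comp (Submodule.mkQ _), fun h0 => hφ ?_⟩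
  refine LinearMap.ext fun m => ?_
  obtain ⟨m, rfl⟩ := Submodule.mkQ_surjective _ m
  exact LinearMap.congr_fun h0 m

/-- one step -/
theorem VM.step {I : Ideal R} {a : Ideal R} {j : ℕ}
    (H2 : ∀ (N : Type u) [AddCommGroup N] [Module R N], (∀ r ∈ I, ∀ n : N, r • n = 0) → VM a (j+1) N)
    (J : Ideal R) (ih : ∀ J' > J, VM a j (R ⧸ J'))
    {X : Type u} [AddCommGroup X] [Module R X] (hX : ∀ r ∈ I, ∀ n : X, r • n = 0)
    (hV : VM a j X) (φ : X →ₗ[R] (R ⧸ J)) (hφ : φ ≠ 0) : VM a j (R ⧸ J) := by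
  refine VM.of_sub (LinearMap.range φ) ?_ ?_
  · refine VM.quot φ.rangeRestrict φ.surjective_rangeRestrict hV (H2 _ ?_)
    rintro r hr ⟨n, hn⟩
    exact Subtype.ext (hX r hr n)
  · let J' : Ideal R := (LinearMap.range φ).comap J.mkQ
    have hle : J ≤ J' := by
      intro r hr
      change J.mkQ r ∈ LinearMap.range φ
      rw [Submodule.mkQ_apply, (Submodule.Quotient.mk_eq_zero J).2 hr]
      exact Submodule.zero_mem _
    have hm : Submodule.map J.mkQ J' = LinearMap.range φ :=
      Submodule.map_comap_eq_of_surjective J.mkQ_surjective _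
    have hlt : J < J' := by
      refine lt_of_le_of_ne hle fun he => hφ ?_
      rw [← LinearMap.range_eq_bot, ← hm, ← he]
      simp
    have e := Submodule.quotientQuotientEquivQuotient J J' hle
    rw [hm] at e
    exact VM.equiv e (ih J' hlt)

theorem VM.cyclic [IsNoetherianRing R] {a : Ideal R} {j : ℕ} (M : Type u) [AddCommGroup M] [Module R M]
    [Module.Finite R M] (H1 : VM a j M)
    (H2 : ∀ (N : Type u) [AddCommGroup N] [Module R N],
      (∀ r ∈ Module.annihilator R M, ∀ n : N, r • n = 0) → VM a (j+1) N)
    (J : Ideal R) (hJ : Module.annihilator R M ≤ J) : VM a j (R ⧸ J) := by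
  induction J using IsNoetherian.induction with
  | hgt J ih =>
  have ih' : ∀ J' > J, VM a j (R ⧸ J') := fun J' h => ih J' h (hJ.trans h.le)
  by_cases ht : J = ⊤
  · have : Subsingleton (R ⧸ J) := Ideal.Quotient.subsingleton_iff.2 ht
    exact VM.of_subsingleton
  by_cases hp : Ideal.IsPrime J
  · obtain ⟨φ, hφ⟩ := exists_ne_zero_prime M J hJ
    exact VM.step H2 J ih' (fun r hr n => Module.mem_annihilator.1 hr n) H1 φ hφ
  · obtain h | ⟨x, hx, y, hy, hxy⟩ := Ideal.not_isPrime_iff.1 hp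
    · exact absurd h ht
    · let J' : Ideal R := Submodule.comap (LinearMap.lsmul R R x) J
      have hle : J ≤ J' := fun r hr => Ideal.mul_mem_left _ _ hr
      have hlt : J < J' := lt_of_le_of_ne hle fun he => hy (by rw [he]; exact hxy)
      refine VM.step H2 J ih' (X := R ⧸ J') ?_ (ih' J' hlt) (Submodule.mapQ J' J (LinearMap.lsmul R R x) le_rfl) ?_
      · intro r hr n
        obtain ⟨n, rfl⟩ := Submodule.Quotient.mk_surjective _ n
        rw [← Submodule.Quotient.mk_smul, Submodule.Quotient.mk_eq_zero]
        exact Ideal.mul_mem_right _ _ (hle (hJ hr))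
      · intro h0
        have h1 := LinearMap.congr_fun h0 (Submodule.Quotient.mk 1)
        have h2 : (Submodule.Quotient.mk (x * 1) : R ⧸ J) = 0 := h1
        rw [Submodule.Quotient.mk_eq_zero, mul_one] at h2
        exact hx h2

theorem VM.devissage [IsNoetherianRing R] {a : Ideal R} {n : ℕ} (M : Type u) [AddCommGroup M] [Module R M]
    [Module.Finite R M] (H : ∀ j ≥ n, VM a j M) (N : Type u) [AddCommGroup N] [Module R N]
    (hN : ∀ r ∈ Module.annihilator R M, ∀ x : N, r • x = 0) : ∀ j ≥ n, VM a j N := by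
  obtain ⟨S, hS⟩ := (isNoetherianRing_iff_ideal_fg R).1 inferInstance a
  have key : ∀ (d j : ℕ), n ≤ j → S.card < j + d → ∀ (N : Type u) [AddCommGroup N] [Module R N],
      (∀ r ∈ Module.annihilator R M, ∀ x : N, r • x = 0) → VM a j N := by
    intro d
    induction d with
    | zero =>
      intro j _ hj N _ _ _
      rw [← hS]
      exact VM.of_card_lt S N j hj
    | succ d ih =>
      intro j hnj hj N _ _ hN
      have H2 := ih (j+1) (by omega) (by omega)
      let I := Module.annihilator R M
      have h1 : VM a j (R ⧸ I) := VM.cyclic M (H j hnj) H2 I le_rfl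
      let π : (N →₀ (R ⧸ I)) →ₗ[R] N := Finsupp.lsum R (fun x : N =>
        Submodule.liftQ I (LinearMap.toSpanSingleton R N x) (fun r hr => hN r hr x))
      have hπ : Function.Surjective π := by
        intro x
        refine ⟨Finsupp.single x (Submodule.Quotient.mk 1), ?_⟩
        rw [Finsupp.lsum_single]
        change LinearMap.toSpanSingleton R N x 1 = x
        simp
      refine VM.quot π hπ (VM.finsupp N h1) (H2 _ ?_)
      rintro r hr ⟨y, hy⟩
      refine Subtype.ext ?_
      change r • y = 0
      ext x
      rw [Finsupp.smul_apply]
      obtain ⟨n, hn⟩ := Submodule.Quotient.mk_surjective _ (y x)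
      rw [← hn, ← Submodule.Quotient.mk_smul]
      exact (Submodule.Quotient.mk_eq_zero _).2 (Ideal.mul_mem_right _ _ hr)
  intro j hj
  exact key (S.card + 1) j hj (by omega) N hN

end CDB

namespace CDB
open Abelian
variable {R : Type u} [CommRing R]

section
variable {T : Type u} [CommRing T] [Algebra R T] 
  {M : Type u} [AddCommGroup M] [Module R M]

theorem pure_extend (hpure : IsPureAlgebra R T) {n m : ℕ} {L : Type u} [AddCommGroup L] [Module R L]
    (l : Fin m → L) (hl : Submodule.span R (Set.range l) = ⊤)
    (f : L →ₗ[R] (Fin n → R)) (x : L →ₗ[R] M) (y : (Fin n → R) →ₗ[R] T ⊗[R] M)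
    (hxy : ∀ z, y (f z) = (1 : T) ⊗ₜ[R] x z) : ∃ z : (Fin n → R) →ₗ[R] M, z.comp f = x := by
  classical
  let α : (Fin n → M) →ₗ[R] (Fin m → M) :=
    LinearMap.pi (fun k => ∑ j, f (l k) j • LinearMap.proj j)
  have hα : ∀ v k, α v k = ∑ j, f (l k) j • v j := by
    intro v k; simp [α]
  let w : Fin m → M := fun k => x (l k)
  let ye : Fin n → T ⊗[R] M := fun j => y (fun i => if j = i then 1 else 0)
  have h1 : ∀ (j : Fin n) (s : T ⊗[R] M),
      LinearMap.lTensor T α (LinearMap.lTensor T (LinearMap.single R (fun _ => M) j) s) =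
      ∑ k, f (l k) j • LinearMap.lTensor T (LinearMap.single R (fun _ : Fin m => M) k) s := by
    intro j s
    induction s using TensorProduct.induction_on with
    | zero => simp
    | add s t hs ht => simp only [map_add, hs, ht, smul_add, Finset.sum_add_distrib]
    | tmul t v =>
      simp only [LinearMap.lTensor_tmul, ← TensorProduct.tmul_smul, ← TensorProduct.tmul_sum]
      congr 1
      ext k
      rw [hα, Finset.sum_apply, Finset.sum_eq_single j, Finset.sum_eq_single k]
      · simp
      · intro b _ hb
        simp [Pi.single_apply, hb.symm]
      · simp
      · intro b _ hb
        simp [Pi.single_apply, hb]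
      · simp
  have hw : w = ∑ k, LinearMap.single R (fun _ : Fin m => M) k (w k) := by
    ext k
    simp [Finset.sum_apply, Pi.single_apply]
  let Y : T ⊗[R] (Fin n → M) := ∑ j, LinearMap.lTensor T (LinearMap.single R (fun _ => M) j) (ye j)
  have h2 : LinearMap.lTensor T α Y = (1 : T) ⊗ₜ[R] w := by
    rw [hw, TensorProduct.tmul_sum, map_sum]
    simp only [h1]
    rw [Finset.sum_comm]
    refine Finset.sum_congr rfl fun k _ => ?_
    rw [← LinearMap.lTensor_tmul, ← hxy (l k), LinearMap.pi_apply_eq_sum_univ y, map_sum]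
    simp only [map_smul]
    rfl
  have h3 : w ∈ LinearMap.range α := by
    rw [← Submodule.Quotient.mk_eq_zero]
    apply hpure ((Fin m → M) ⧸ LinearMap.range α)
    change (1 : T) ⊗ₜ[R] (LinearMap.range α).mkQ w = (1 : T) ⊗ₜ[R] 0
    rw [← LinearMap.lTensor_tmul, ← h2, ← LinearMap.comp_apply, ← LinearMap.lTensor_comp]
    have : (LinearMap.range α).mkQ ∘ₗ α = 0 := LinearMap.range_mkQ_comp α
    rw [this]
    simp
  obtain ⟨v, hv⟩ := h3
  refine ⟨∑ j, (LinearMap.proj j : (Fin n → R) →ₗ[R] R).smulRight (v j), ?_⟩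
  refine LinearMap.ext_on_range hl fun k => ?_
  have := congrFun hv k
  rw [hα] at this
  simpa using this

/-- the map `M → T ⊗ M` -/
abbrev um (T M : Type u) [CommRing T] [Algebra R T] [AddCommGroup M] [Module R M] :
    ModuleCat.of R M ⟶ ModuleCat.of R (T ⊗[R] M) :=
  ModuleCat.ofHom (TensorProduct.mk R T M 1)

theorem pure_ext_inj [IsNoetherianRing R] (hpure : IsPureAlgebra R T) (i : ℕ) :
    ∀ (L : Type u) [AddCommGroup L] [Module R L] [Module.Finite R L]
      (e : Ext (ModuleCat.of R L) (ModuleCat.of R M) i),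
      e.comp (Ext.mk₀ (um T M)) (add_zero i) = 0 → e = 0 := by
  induction i with
  | zero =>
    intro L _ _ _ e he
    have hmono : Mono (um T M) := (ModuleCat.mono_iff_injective _).2 (hpure M)
    apply Ext.postcomp_mk₀_injective_of_mono (ModuleCat.of R L) (um T M)
    rw [map_zero]
    exact he
  | succ i ih =>
    intro L _ _ _ e he
    obtain ⟨n, π, hπ⟩ := Module.Finite.exists_fin' R L
    have hS := SC_exact (LinearMap.ker π).injective_subtype (LinearMap.exact_subtype_ker_map π) hπ
    have hproj : Projective (ModuleCat.of R (Fin n → R)) :=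
      (IsProjective.iff_projective _).1 inferInstance
    obtain ⟨x, hx⟩ := Ext.contravariant_sequence_exact₃ hS _ e
      (@Ext.eq_zero_of_projective _ _ _ _ _ _ _ hproj _) (add_comm 1 i)
    have h0 : hS.extClass.comp (x.comp (Ext.mk₀ (um T M)) (add_zero i)) (add_comm 1 i) = 0 := by
      rw [← he, ← hx, Ext.comp_assoc_of_third_deg_zero]
    obtain ⟨y, hy⟩ := Ext.contravariant_sequence_exact₁ hS _ _ _ h0
    cases i with
    | zero =>
      obtain ⟨x, rfl⟩ := Ext.homEquiv₀.symm.surjective x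
      obtain ⟨y, rfl⟩ := Ext.homEquiv₀.symm.surjective y
      have hy' : Ext.mk₀ (ModuleCat.ofHom (LinearMap.ker π).subtype ≫ y) = Ext.mk₀ (x ≫ um T M) := by
        rw [← Ext.mk₀_comp_mk₀, ← Ext.mk₀_comp_mk₀]; exact hy
      have h1 := Ext.homEquiv₀.symm.injective hy'
      obtain ⟨m, l, hl⟩ := Module.Finite.exists_fin (R := R) (M := LinearMap.ker π)
      obtain ⟨z, hz⟩ := pure_extend hpure l hl (LinearMap.ker π).subtype x.hom y.hom (fun p => by
        exact congrArg (fun q => q.hom p) h1)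
      have h2 : x = ModuleCat.ofHom (LinearMap.ker π).subtype ≫ ModuleCat.ofHom z := by
        ext p
        exact (LinearMap.congr_fun hz p).symm
      rw [← hx, h2]
      change hS.extClass.comp (Ext.mk₀ _) _ = 0
      rw [← Ext.mk₀_comp_mk₀]
      exact hS.extClass_comp_assoc _
    | succ i =>
      have hy0 : y = 0 := @Ext.eq_zero_of_projective _ _ _ _ _ _ _ hproj _
      rw [hy0, Ext.comp_zero] at hy
      have : x = 0 := ih _ x hy.symm
      rw [← hx, this, Ext.comp_zero]

theorem VM.of_pure [IsNoetherianRing R] (hpure : IsPureAlgebra R T) {a : Ideal R} {i : ℕ}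
    (h : VM a i (T ⊗[R] M)) : VM a i M := by
  intro t e
  obtain ⟨s, hts, hs⟩ := h t (e.comp (Ext.mk₀ (um T M)) (add_zero i))
  refine ⟨s, hts, pure_ext_inj hpure i _ _ ?_⟩
  rw [← hs, Ext.comp_assoc_of_third_deg_zero]
end

theorem nontrivial_iff (a : Ideal R) (i : ℕ) (N : Type u) [AddCommGroup N] [Module R N] :
    Nontrivial ((localCohomology a i).obj (ModuleCat.of R N)) ↔ ¬ VM a i N := by
  rw [← not_subsingleton_iff_nontrivial, ← V_iff]
  rfl

end CDB

theorem stmt1 {R T : Type u} [CommRing R] [CommRing T] [Algebra R T]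
    [IsNoetherianRing R] [IsNoetherianRing T]
    (hpure : IsPureAlgebra R T) (a : Ideal R) (ha : a ≠ ⊤)
    (M : Type u) [AddCommGroup M] [Module R M] [Module.Finite R M] :
    cohDim a M = cohDim (a.map (algebraMap R T)) (T ⊗[R] M) := by
  unfold cohDim
  simp only [CDB.nontrivial_iff, ← CDB.VM.tower_iff a _ (N := T ⊗[R] M)]
  apply le_antisymm
  · refine sSup_le_sSup (Set.image_mono ?_)
    intro i hi h
    exact hi (CDB.VM.of_pure hpure h)
  · refine sSup_le ?_
    rintro _ ⟨i, hi, rfl⟩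
    by_contra hlt
    refine hi (CDB.VM.devissage (n := i) M ?_ (T ⊗[R] M) ?_ i le_rfl)
    · intro j hj
      by_contra hV
      refine hlt (le_trans ?_ (le_sSup ⟨j, hV, rfl⟩))
      exact Nat.cast_le.2 hj
    · intro r hr x
      induction x using TensorProduct.induction_on with
      | zero => simp
      | add x y hx hy => rw [smul_add, hx, hy, add_zero]
      | tmul t m => rw [← TensorProduct.tmul_smul, Module.mem_annihilator.1 hr m, TensorProduct.tmul_zero]

end
end

section
/- Let f : R → T be a pure ring homomorphism of commutative Noetherian rings, 𝔞 a proper ideal of R, and M a finitely generated R-module. If T ⊗_R M is 𝔞T-relative Cohen-Macaulay over T, then M is 𝔞-relative Cohen-Macaulay over R. -/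
open CategoryTheory TensorProduct

noncomputable section

universe u

section bridge
variable {R : Type u} [CommRing R]

lemma abs_square {C : Type*} [Category C] {A A' B B' H H' : C} (m : A ⟶ A') (iA : B ≅ A)
    (iA' : B' ≅ A') (k : B ⟶ B') (h1 : iA.hom ≫ m = k ≫ iA'.hom) (j : H ≅ B) (j' : H' ≅ B')
    (l : H ⟶ H') (h2 : l ≫ j'.hom = j.hom ≫ k) :
    m ≫ (iA'.symm ≪≫ j'.symm).hom = (iA.symm ≪≫ j.symm).hom ≫ l := by
  rw [← cancel_epi iA.hom, ← cancel_mono j'.hom]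
  simp [h2, reassoc_of% h1]

lemma isoExt_nat {X X' Y : ModuleCat.{u} R} (g : X' ⟶ X) (P : ProjectiveResolution X)
    (P' : ProjectiveResolution X') (φ : P'.complex ⟶ P.complex)
    (comm : φ.f 0 ≫ P.π.f 0 = P'.π.f 0 ≫ g) (n : ℕ) :
    ((Ext R (ModuleCat.{u} R) n).map g.op).app Y ≫ (P'.isoExt (R := R) n Y).hom =
    (P.isoExt (R := R) n Y).hom ≫ HomologicalComplex.homologyMap
      ((HomologicalComplex.unopFunctor _ _).map
        ((((linearYoneda R (ModuleCat.{u} R)).obj Y).rightOp.mapHomologicalComplex _).map φ).op) n := by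
  have h := ProjectiveResolution.isoLeftDerivedObj_hom_naturality g P' P φ comm
    ((linearYoneda R (ModuleCat.{u} R)).obj Y).rightOp n
  have h2 := HomologicalComplex.homologyOp_hom_naturality ((HomologicalComplex.unopFunctor _ _).map
        ((((linearYoneda R (ModuleCat.{u} R)).obj Y).rightOp.mapHomologicalComplex _).map φ).op) n
  have h' := congrArg Quiver.Hom.unop h
  have h2' := congrArg Quiver.Hom.unop h2
  exact abs_square _ (P.isoLeftDerivedObj ((linearYoneda R (ModuleCat.{u} R)).obj Y).rightOp n).unop
   (P'.isoLeftDerivedObj ((linearYoneda R (ModuleCat.{u} R)).obj Y).rightOp n).unop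
   _ h' (HomologicalComplex.homologyUnop _ _) (HomologicalComplex.homologyUnop _ _) _ h2'.symm

lemma extMk_zero_iff {X Y : ModuleCat.{u} R} (P : ProjectiveResolution X)
    (f : P.complex.X 0 ⟶ Y) (hf : P.complex.d 1 0 ≫ f = 0) :
    P.extMk f 1 rfl hf = 0 ↔ f = 0 := by
  constructor
  · simp only [← P.extEquivCohomologyClass.apply_eq_iff_eq,
      ProjectiveResolution.extEquivCohomologyClass_extMk, ProjectiveResolution.extEquivCohomologyClass_zero,
      CochainComplex.HomComplex.CohomologyClass.mk_eq_zero_iff]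
    rw [CochainComplex.HomComplex.Cocycle.toSingleMk_mem_coboundaries_iff _ _ _ _ _ (1) (by lia)]
    rintro ⟨g, hg⟩
    have : g = 0 := by
      apply Limits.IsZero.eq_of_src
      exact HomologicalComplex.isZero_extend_X _ _ _ (fun i => by change -(i:ℤ) ≠ 1; lia)
    subst this
    rw [← cancel_epi (P.cochainComplexXIso (-(0:ℕ)) 0 rfl).hom]
    simpa using hg.symm
  · rintro rfl; simp

/-- `f` is a cocycle representing `e`. -/
def ERel {X Y : ModuleCat.{u} R} (P : ProjectiveResolution X) (n : ℕ) (f : P.complex.X n ⟶ Y)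
    (e : ((Ext R (ModuleCat.{u} R) n).obj (Opposite.op X)).obj Y) : Prop :=
  ∃ z : (P.complex.linearYonedaObj R Y).cycles n,
    (P.complex.linearYonedaObj R Y).iCycles n z = f ∧
    (P.complex.linearYonedaObj R Y).homologyπ n z = (P.isoExt n Y).hom e

variable {X X' Y : ModuleCat.{u} R} (P : ProjectiveResolution X) (n : ℕ)

lemma next_eq : (ComplexShape.down ℕ).symm.next n = n + 1 := by
  exact ComplexShape.next_eq' _ (by simp)

lemma ERel.cocycle {P : ProjectiveResolution X} {n : ℕ} {f : P.complex.X n ⟶ Y} {e} (h : ERel P n f e) :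
    P.complex.d (n+1) n ≫ f = 0 := by
  obtain ⟨z, rfl, -⟩ := h
  have := (P.complex.linearYonedaObj R Y).iCycles_d n (n+1)
  exact congr($this z)

lemma ERel.exists_left (e : ((Ext R (ModuleCat.{u} R) n).obj (Opposite.op X)).obj Y) :
    ∃ f, ERel P n f e := by
  obtain ⟨z, hz⟩ := (ModuleCat.epi_iff_surjective ((P.complex.linearYonedaObj R Y).homologyπ n)).1
    inferInstance ((P.isoExt n Y).hom e)
  exact ⟨_, z, rfl, hz⟩

lemma ERel.exists_right (f : P.complex.X n ⟶ Y) (hf : P.complex.d (n+1) n ≫ f = 0) :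
    ∃ e, ERel P n f e := by
  let K := P.complex.linearYonedaObj R Y
  let k : ModuleCat.of R R ⟶ K.X n := ModuleCat.ofHom (LinearMap.toSpanSingleton R (K.X n) f)
  have hk : k ≫ K.d n (n+1) = 0 := by
    ext
    exact (congrArg (fun t => P.complex.d (n+1) n ≫ t) (one_smul R f)).trans hf
  let l := K.liftCycles k (n+1) (next_eq n) hk
  have hl : l ≫ K.iCycles n = k := K.liftCycles_i _ _ _ _
  refine ⟨(P.isoExt n Y).inv (K.homologyπ n (l (1:R))), l (1:R), ?_, ?_⟩
  · refine (congr($hl (1:R))).trans ?_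
    exact one_smul R f
  · simp [K]

lemma ERel.zero_iff {f : P.complex.X n ⟶ Y} {e} (h : ERel P n f e) :
    e = 0 ↔ ∃ g : P.complex.X ((ComplexShape.down ℕ).symm.prev n) ⟶ Y, P.complex.d n _ ≫ g = f := by
  obtain ⟨z, rfl, hz⟩ := h
  let K := P.complex.linearYonedaObj R Y
  have h1 : e = 0 ↔ K.homologyπ n z = 0 := by
    rw [hz]
    constructor
    · rintro rfl; simp
    · intro h
      simpa using congr((P.isoExt n Y).inv $h)
  rw [h1]
  have hex := ShortComplex.exact_of_g_is_cokernel
    (ShortComplex.mk _ _ (K.toCycles_comp_homologyπ ((ComplexShape.down ℕ).symm.prev n) n))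
    (K.homologyIsCokernel _ n rfl)
  rw [ShortComplex.moduleCat_exact_iff] at hex
  have hi := K.toCycles_i ((ComplexShape.down ℕ).symm.prev n) n
  constructor
  · intro hz0
    obtain ⟨g, hg⟩ := hex z hz0
    refine ⟨g, ?_⟩
    refine (congr($hi g)).symm.trans ?_
    exact congr(K.iCycles n $hg)
  · rintro ⟨g, hg⟩
    have : K.toCycles ((ComplexShape.down ℕ).symm.prev n) n g = z := by
      apply (ModuleCat.mono_iff_injective (K.iCycles n)).1 inferInstance
      exact (congr($hi g)).trans hg
    rw [← this]
    exact congr($(K.toCycles_comp_homologyπ ((ComplexShape.down ℕ).symm.prev n) n) g)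

lemma extMk_zero_iff' (f : P.complex.X n ⟶ Y) (hf : P.complex.d (n+1) n ≫ f = 0) :
    P.extMk f (n+1) rfl hf = 0 ↔
      ∃ g : P.complex.X ((ComplexShape.down ℕ).symm.prev n) ⟶ Y, P.complex.d n _ ≫ g = f := by
  cases n with
  | zero =>
    rw [extMk_zero_iff]
    have : P.complex.d 0 ((ComplexShape.down ℕ).symm.prev 0) = 0 :=
      P.complex.shape _ _ (by simp)
    simp [eq_comm]
  | succ n =>
    have h : (ComplexShape.down ℕ).symm.prev (n+1) = n := ComplexShape.prev_eq' _ (by simp)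
    rw [h]
    exact P.extMk_eq_zero_iff _ _ _ _ _ rfl

lemma ERel.nat {P : ProjectiveResolution X} {n : ℕ} {f : P.complex.X n ⟶ Y} {e} (h : ERel P n f e)
    {P' : ProjectiveResolution X'} {g : X' ⟶ X} (φ : ProjectiveResolution.Hom P' P g) :
    ERel P' n (φ.hom.f n ≫ f) (((Ext R (ModuleCat.{u} R) n).map g.op).app Y e) := by
  obtain ⟨z, rfl, hz⟩ := h
  have h1 := isoExt_nat (Y := Y) g P P' φ.hom φ.hom_f_zero_comp_π_f_zero n
  let ψ := ((HomologicalComplex.unopFunctor _ _).map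
        ((((linearYoneda R (ModuleCat.{u} R)).obj Y).rightOp.mapHomologicalComplex _).map φ.hom).op)
  refine ⟨HomologicalComplex.cyclesMap ψ n z, ?_, ?_⟩
  · have := HomologicalComplex.cyclesMap_i ψ n
    exact congr($this z)
  · have h2 := HomologicalComplex.homologyπ_naturality ψ n
    refine (congr($h2 z)).symm.trans ?_
    refine Eq.trans ?_ (congr($h1 e)).symm
    exact congr(HomologicalComplex.homologyMap ψ n $hz)

variable {ι : Type*}
abbrev NExt (X Y : ModuleCat.{u} R) (n : ℕ) := Abelian.Ext.{u} X Y n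

lemma ext_subsingleton_iff (X Y : ModuleCat.{u} R) (n : ℕ) :
    Subsingleton (((Ext R (ModuleCat.{u} R) n).obj (Opposite.op X)).obj Y) ↔
      ∀ e : NExt X Y n, e = 0 := by
  let P := projectiveResolution X
  constructor
  · intro h e
    obtain ⟨f, hf, rfl⟩ := P.extMk_surjective e (n+1) rfl
    obtain ⟨e', he'⟩ := ERel.exists_right P n f hf
    exact (extMk_zero_iff' P n f hf).2 ((ERel.zero_iff P n he').1 (Subsingleton.elim _ _))
  · intro h
    refine subsingleton_of_forall_eq 0 fun e => ?_
    obtain ⟨f, hf⟩ := ERel.exists_left P n e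
    exact (ERel.zero_iff P n hf).2 ((extMk_zero_iff' P n f hf.cocycle).1 (h _))

lemma ext_map_zero_iff (X Y : ModuleCat.{u} R) (n : ℕ) {κ : Type*} (X' : κ → ModuleCat.{u} R)
    (g : ∀ k, X' k ⟶ X) :
    (∀ e : ((Ext R (ModuleCat.{u} R) n).obj (Opposite.op X)).obj Y,
      ∃ k, ((Ext R (ModuleCat.{u} R) n).map (g k).op).app Y e = 0) ↔
    (∀ e : NExt X Y n, ∃ k, (Abelian.Ext.mk₀ (g k)).comp e (zero_add n) = 0) := by
  let P := projectiveResolution X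
  let P' := fun k => projectiveResolution (X' k)
  let φ : ∀ k, ProjectiveResolution.Hom (P' k) P (g k) := fun k =>
    ⟨ProjectiveResolution.lift (g k) _ _, by
      exact ProjectiveResolution.lift_commutes_zero _ _ _⟩
  constructor
  · intro h e
    obtain ⟨f, hf, rfl⟩ := P.extMk_surjective e (n+1) rfl
    obtain ⟨e', he'⟩ := ERel.exists_right P n f hf
    obtain ⟨k, hk⟩ := h e'
    refine ⟨k, ?_⟩
    rw [ProjectiveResolution.mk₀_comp_extMk f (n+1) rfl hf (φ k)]
    exact (extMk_zero_iff' _ n _ _).2 ((ERel.zero_iff _ n (he'.nat (φ k))).1 hk)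
  · intro h e
    obtain ⟨f, hf⟩ := ERel.exists_left P n e
    obtain ⟨k, hk⟩ := h (P.extMk f (n+1) rfl hf.cocycle)
    refine ⟨k, ?_⟩
    rw [ProjectiveResolution.mk₀_comp_extMk f (n+1) rfl _ (φ k)] at hk
    exact (ERel.zero_iff _ n (hf.nat (φ k))).2 ((extMk_zero_iff' _ n _ _).1 hk)

/-- transition maps -/
def powQ (a : Ideal R) {m n : ℕ} (h : n ≤ m) :
    ModuleCat.of R (R ⧸ a ^ m) ⟶ ModuleCat.of R (R ⧸ a ^ n) :=
  ModuleCat.ofHom <| Submodule.mapQ _ _ LinearMap.id (Ideal.pow_le_pow_right h)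

/-- vanishing of local cohomology. -/
def LCV (a : Ideal R) (Y : ModuleCat.{u} R) (i : ℕ) : Prop :=
  ∀ n, ∀ e : NExt (ModuleCat.of R (R ⧸ a ^ n)) Y i, ∃ m, ∃ h : n ≤ m,
    (Abelian.Ext.mk₀ (powQ a h)).comp e (zero_add i) = 0

open Limits in
lemma colim_subsingleton_iff {J : Type} [SmallCategory J] [IsFiltered J]
    (F : J ⥤ ModuleCat.{u} R ⥤ ModuleCat.{u} R) (Y : ModuleCat.{u} R) :
    Subsingleton ((colimit F).obj Y) ↔
    ∀ j, ∀ e : (F.obj j).obj Y, ∃ k, ∃ g : j ⟶ k, (F.map g).app Y e = 0 := by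
  have : PreservesFilteredColimitsOfSize.{0, 0} (forget (ModuleCat.{u} R)) :=
    preservesFilteredColimitsOfSize_shrink.{0, u, 0, u} _
  let hc := isColimitOfPreserves ((evaluation _ _).obj Y) (colimit.isColimit F)
  constructor
  · intro h j e
    have : (((evaluation _ _).obj Y).mapCocone (colimit.cocone F)).ι.app j e =
      (((evaluation _ _).obj Y).mapCocone (colimit.cocone F)).ι.app j 0 :=
      (show Subsingleton ((colimit F).obj Y) from h).elim _ _
    obtain ⟨k, f, g, hh⟩ := Concrete.isColimit_exists_of_rep_eq _ hc _ _ this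
    refine ⟨k, f, ?_⟩
    simpa using hh
  · intro h
    refine subsingleton_of_forall_eq 0 fun x => ?_
    obtain ⟨j, e, he⟩ := Concrete.isColimit_exists_rep _ hc x
    obtain ⟨k, g, hg⟩ := h j e
    have := (((evaluation _ _).obj Y).mapCocone (colimit.cocone F)).w g
    have h2 := congr($this e)
    refine he.symm.trans (h2.symm.trans ?_)
    refine (congr((((evaluation _ _).obj Y).mapCocone (colimit.cocone F)).ι.app k $hg)).trans ?_
    exact map_zero _

lemma lc_subsingleton_iff (a : Ideal R) (Y : ModuleCat.{u} R) (i : ℕ) :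
    Subsingleton ((localCohomology a i).obj Y) ↔ LCV a Y i := by
  refine (colim_subsingleton_iff _ Y).trans ?_
  have key := fun n : ℕ => ext_map_zero_iff (ModuleCat.of R (R ⧸ a ^ n)) Y i
    (fun k : {m // n ≤ m} => (ModuleCat.of R (R ⧸ a ^ k.1))) (fun k => powQ a k.2)
  constructor
  · intro h n e
    obtain ⟨⟨m, hm⟩, h1⟩ := (key n).1 (fun e => by
      obtain ⟨k, g, hk⟩ := h (Opposite.op (Opposite.op n)) e
      exact ⟨⟨k.unop.unop, g.unop.unop.down.down⟩, hk⟩) e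
    exact ⟨m, hm, h1⟩
  · intro h n e
    obtain ⟨⟨m, hm⟩, h1⟩ := (key n.unop.unop).2 (fun e => by
      obtain ⟨m, hm, h1⟩ := h _ e
      exact ⟨⟨m, hm⟩, h1⟩) e
    exact ⟨Opposite.op (Opposite.op m), (homOfLE hm).op.op, h1⟩
end bridge

section grade
variable {R : Type u} [CommRing R]

/-- Vanishing of an Ext group. -/
def EV (X Y : ModuleCat.{u} R) (n : ℕ) : Prop := ∀ e : NExt X Y n, e = 0

lemma ev_mid {S : ShortComplex (ModuleCat.{u} R)} (hS : S.ShortExact) {Y : ModuleCat.{u} R} {n : ℕ}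
    (h1 : EV S.X₁ Y n) (h3 : EV S.X₃ Y n) : EV S.X₂ Y n := by
  intro e
  obtain ⟨x, rfl⟩ := Abelian.Ext.contravariant_sequence_exact₂ hS Y e (h1 _)
  rw [h3 x, Abelian.Ext.comp_zero]

lemma ext_inj_of_ev {S : ShortComplex (ModuleCat.{u} R)} (hS : S.ShortExact) {Y : ModuleCat.{u} R}
    {n : ℕ} (h1 : ∀ k, k + 1 = n → EV S.X₁ Y k) (e : NExt S.X₃ Y n)
    (he : (Abelian.Ext.mk₀ S.g).comp e (zero_add n) = 0) : e = 0 := by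
  cases n with
  | zero =>
    have := hS.epi_g
    exact Abelian.Ext.precomp_mk₀_injective_of_epi Y S.g (he.trans (by simp))
  | succ n =>
    obtain ⟨x, rfl⟩ := Abelian.Ext.contravariant_sequence_exact₃ hS Y e he (add_comm 1 n)
    rw [h1 n rfl x, Abelian.Ext.comp_zero]

lemma ev_right {S : ShortComplex (ModuleCat.{u} R)} (hS : S.ShortExact) {Y : ModuleCat.{u} R}
    {n : ℕ} (h1 : ∀ k, k + 1 = n → EV S.X₁ Y k) (h2 : EV S.X₂ Y n) : EV S.X₃ Y n :=
  fun e => ext_inj_of_ev hS h1 e (h2 _)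

lemma ev_pi {X : Type u} [AddCommGroup X] [Module R X] {Y : ModuleCat.{u} R} {n : ℕ} (k : ℕ)
    (h : EV (ModuleCat.of R X) Y n) : EV (ModuleCat.of R (Fin k → X)) Y n := by
  intro e
  have hid : (𝟙 (ModuleCat.of R (Fin k → X))) = ∑ i : Fin k,
      ModuleCat.ofHom (LinearMap.proj (R := R) (φ := fun _ : Fin k => X) i) ≫ 
      ModuleCat.ofHom (LinearMap.single R (fun _ : Fin k => X) i) := by
    ext1
    simp only [ModuleCat.hom_id, ModuleCat.hom_sum, ModuleCat.hom_comp, ModuleCat.hom_ofHom]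
    ext v j
    simp [Pi.single_apply]
  rw [← Abelian.Ext.mk₀_id_comp e, hid, Abelian.Ext.mk₀_sum, Abelian.Ext.sum_comp]
  refine Finset.sum_eq_zero fun i _ => ?_
  rw [← Abelian.Ext.mk₀_comp_mk₀_assoc]
  refine (congrArg (fun t => Abelian.Ext.comp _ t (zero_add n)) (h _)).trans ?_
  exact Abelian.Ext.comp_zero ..

lemma pow_le_ann_quot (a : Ideal R) (n : ℕ) : a ^ n ≤ Module.annihilator R (R ⧸ a ^ n) := by
  rw [Ideal.annihilator_quotient]

variable [IsNoetherianRing R] (a : Ideal R)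

lemma ev_below {Y : ModuleCat.{u} R} (g : ℕ)
    (hg : ∀ j < g, EV (ModuleCat.of R (R ⧸ a)) Y j) (j : ℕ) (hj : j < g) : ∀ (n : ℕ)
    (X : Type u) [AddCommGroup X] [Module R X] [Module.Finite R X]
    (_ : a ^ n ≤ Module.annihilator R X), EV (ModuleCat.of R X) Y j := by
  induction j using Nat.strong_induction_on with
  | _ j ih =>
  have base : ∀ (X : Type u) [AddCommGroup X] [Module R X] [Module.Finite R X]
      (_ : a ≤ Module.annihilator R X), EV (ModuleCat.of R X) Y j := by
    intro X _ _ _ hX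
    obtain ⟨k, s, hs⟩ := Module.Finite.exists_fin (R := R) (M := X)
    let f1 : Fin k → ((R ⧸ a) →ₗ[R] X) := fun i =>
      Submodule.liftQ a (LinearMap.toSpanSingleton R X (s i)) (fun r hr => by
        simpa using Module.mem_annihilator.1 (hX hr) (s i))
    let f : (Fin k → (R ⧸ a)) →ₗ[R] X := ∑ i, f1 i ∘ₗ LinearMap.proj i
    have hf : Function.Surjective f := by
      rw [← LinearMap.range_eq_top, ← top_le_iff, ← hs, Submodule.span_le]
      rintro _ ⟨i, rfl⟩
      refine ⟨Pi.single i (Submodule.Quotient.mk 1), ?_⟩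
      simp only [f, LinearMap.sum_apply, LinearMap.comp_apply, LinearMap.proj_apply]
      rw [Finset.sum_eq_single i]
      · rw [Pi.single_eq_same]
        exact one_smul R (s i)
      · intro b _ hb
        simp [Pi.single_eq_of_ne hb]
      · simp
    refine ev_right (LinearMap.shortExact_shortComplexKer hf) ?_ (ev_pi k (hg j hj))
    rintro l rfl
    refine ih l (by lia) (by lia) 1 (LinearMap.ker f) ?_
    intro r hr
    rw [pow_one] at hr
    rw [Module.mem_annihilator]
    rintro ⟨v, hv⟩
    ext i
    simp only [SetLike.mk_smul_mk, Pi.smul_apply, ZeroMemClass.coe_zero, Pi.zero_apply]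
    obtain ⟨t, ht⟩ := Submodule.Quotient.mk_surjective a (v i)
    rw [← ht, ← Submodule.Quotient.mk_smul, Submodule.Quotient.mk_eq_zero]
    exact a.mul_mem_right _ hr
  intro n
  induction n with
  | zero =>
    intro X _ _ _ hX
    exact base X (le_trans (by simp) hX)
  | succ n ihn =>
    intro X _ _ _ hX
    have hS := LinearMap.shortExact_shortComplexKer (Submodule.mkQ_surjective (a • (⊤ : Submodule R X)))
    refine ev_mid hS ?_ ?_
    · have : LinearMap.ker (a • (⊤ : Submodule R X)).mkQ = a • (⊤ : Submodule R X) :=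
        Submodule.ker_mkQ _
      refine ihn (LinearMap.ker (a • (⊤ : Submodule R X)).mkQ) ?_
      intro r hr
      rw [Module.mem_annihilator]
      rintro ⟨x, hx⟩
      rw [this] at hx
      ext
      simp only [SetLike.mk_smul_mk, ZeroMemClass.coe_zero]
      refine Submodule.smul_induction_on hx ?_ ?_
      · intro t ht y _
        rw [← mul_smul]
        exact Module.mem_annihilator.1 (hX (by rw [pow_succ]; exact Ideal.mul_mem_mul hr ht)) y
      · intro x y hx hy
        rw [smul_add, hx, hy, add_zero]
    · refine base (X ⧸ a • (⊤ : Submodule R X)) ?_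
      intro r hr
      rw [Module.mem_annihilator]
      intro y
      obtain ⟨y, rfl⟩ := Submodule.Quotient.mk_surjective _ y
      rw [← Submodule.Quotient.mk_smul, Submodule.Quotient.mk_eq_zero]
      exact Submodule.smul_mem_smul hr trivial

lemma lcv_below {Y : ModuleCat.{u} R} (g : ℕ)
    (hg : ∀ j < g, EV (ModuleCat.of R (R ⧸ a)) Y j) (j : ℕ) (hj : j < g) : LCV a Y j := by
  intro n e
  refine ⟨n, le_rfl, ?_⟩
  rw [ev_below a g hg j hj n (R ⧸ a ^ n) (pow_le_ann_quot a n) e, Abelian.Ext.comp_zero]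

lemma not_lcv_grade {Y : ModuleCat.{u} R} (g : ℕ)
    (hg : ∀ j < g, EV (ModuleCat.of R (R ⧸ a)) Y j) (h : LCV a Y g) :
    EV (ModuleCat.of R (R ⧸ a)) Y g := by
  have h1 : EV (ModuleCat.of R (R ⧸ a ^ 1)) Y g := by
    intro e
    obtain ⟨m, hm, h0⟩ := h 1 e
    have hsurj : Function.Surjective (powQ a hm).hom := by
      intro y
      obtain ⟨y, rfl⟩ := Submodule.Quotient.mk_surjective _ y
      exact ⟨Submodule.Quotient.mk y, rfl⟩
    refine ext_inj_of_ev (LinearMap.shortExact_shortComplexKer hsurj) ?_ e h0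
    rintro k rfl
    refine ev_below a _ hg k (by lia) m (LinearMap.ker (powQ a hm).hom) ?_
    refine (pow_le_ann_quot a m).trans ?_
    exact LinearMap.annihilator_le_of_injective (LinearMap.ker (powQ a hm).hom).subtype
      (Submodule.injective_subtype _)
  rwa [pow_one] at h1

open Pointwise in
lemma eq_top_of_all_ev (M : Type u) [AddCommGroup M] [Module R M] [Module.Finite R M]
    (h : ∀ i, EV (ModuleCat.of R (R ⧸ a)) (ModuleCat.of R M) i) :
    a • (⊤ : Submodule R M) = ⊤ := by
  suffices H : ∀ N : Submodule R M, ∀ (M' : Type u) [AddCommGroup M'] [Module R M']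
      (π : M →ₗ[R] M'), Function.Surjective π → LinearMap.ker π = N →
      (∀ i, EV (ModuleCat.of R (R ⧸ a)) (ModuleCat.of R M') i) → a • (⊤ : Submodule R M') = ⊤ from
    H ⊥ M LinearMap.id Function.surjective_id LinearMap.ker_id h
  intro N
  induction N using IsNoetherian.induction with
  | _ N ih =>
  intro M' _ _ π hπ hN hev
  have : Module.Finite R M' := Module.Finite.of_surjective π hπ
  obtain ⟨x, hxa, hx⟩ : ∃ x ∈ a, IsSMulRegular M' x := by
    by_contra! hcon
    have hsub : (a : Set R) ⊆ ⋃ p ∈ associatedPrimes R M', (p : Set R) := by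
      rw [biUnion_associatedPrimes_eq_compl_regular]
      intro x hx
      exact hcon x hx
    have hfin := associatedPrimes.finite R M'
    obtain ⟨p, hp, hap⟩ : ∃ p ∈ associatedPrimes R M', a ≤ p := by
      have := (Ideal.subset_union_prime (s := hfin.toFinset) (f := id) ⊥ ⊥ (fun p hp _ _ => by
        exact ((hfin.mem_toFinset).1 hp).isPrime) (I := a)).1 (by simpa using hsub)
      simpa using this
    obtain ⟨hpp, m, hm⟩ := isAssociatedPrime_iff.1 hp
    have hann : ∀ r ∈ a, r • m = 0 := by
      intro r hr
      have := hap hr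
      rw [hm] at this
      simpa using this
    have hm0 : m ≠ 0 := by
      rintro rfl
      apply hpp.ne_top
      rw [hm]
      simp
    let φ : (R ⧸ a) →ₗ[R] M' := Submodule.liftQ a (LinearMap.toSpanSingleton R M' m) (fun r hr => by
        simpa using hann r hr)
    have h1 : φ (Submodule.Quotient.mk 1) = m := one_smul R m
    have h2 := hev 0 (Abelian.Ext.mk₀ (ModuleCat.ofHom φ))
    have h3 : ModuleCat.ofHom φ = 0 := (Abelian.Ext.mk₀_eq_zero_iff _).1 h2
    apply hm0
    rw [← h1]
    exact congr($h3 (Submodule.Quotient.mk 1))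
  have hS := IsSMulRegular.smulShortComplex_shortExact (M := ModuleCat.of R M') hx
  have hev' : ∀ i, EV (ModuleCat.of R (R ⧸ a)) (ModuleCat.of R (M' ⧸ x • (⊤ : Submodule R M'))) i := by
    intro i e
    obtain ⟨y, rfl⟩ := Abelian.Ext.covariant_sequence_exact₃ _ hS e rfl (hev _ _)
    exact (congrArg (fun t => Abelian.Ext.comp t _ (add_zero i)) (hev i y)).trans
      (Abelian.Ext.zero_comp ..)
  let π' := (x • (⊤ : Submodule R M')).mkQ ∘ₗ π
  have hle : N ≤ LinearMap.ker π' := by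
    rw [← hN]
    exact LinearMap.ker_le_ker_comp _ _
  have hxle : x • (⊤ : Submodule R M') ≤ a • ⊤ := by
    rw [← Submodule.ideal_span_singleton_smul]
    exact Submodule.smul_mono_left ((Ideal.span_singleton_le_iff_mem _).2 hxa)
  rcases hle.lt_or_eq with hlt | heq
  · have := ih _ hlt _ π' ((Submodule.mkQ_surjective _).comp hπ) rfl hev'
    have h2 := congrArg (Submodule.comap (x • (⊤ : Submodule R M')).mkQ) this
    rw [Submodule.comap_top, ← LinearMap.range_eq_top.2 (Submodule.mkQ_surjective _),
      LinearMap.range_eq_map, ← Submodule.map_smul'', Submodule.comap_map_eq, Submodule.ker_mkQ,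
      sup_eq_left.2 hxle] at h2
    exact h2
  · have hbot : x • (⊤ : Submodule R M') = ⊥ := by
      rw [eq_bot_iff]
      intro y hy
      obtain ⟨z, rfl⟩ := hπ y
      have : z ∈ LinearMap.ker π' := by
        simpa [π'] using hy
      rw [← heq, ← hN] at this
      simpa using this
    have : Subsingleton M' := by
      refine subsingleton_of_forall_eq 0 fun y => ?_
      apply hx
      have : x • y ∈ x • (⊤ : Submodule R M') := Submodule.smul_mem_pointwise_smul _ _ _ trivial
      rw [hbot] at this
      simpa using this
    exact Subsingleton.elim _ _
end grade

section pure
variable {R T : Type u} [CommRing R] [CommRing T] [Algebra R T]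

lemma pure_lift (hpure : ∀ (N : Type u) [AddCommGroup N] [Module R N],
    Function.Injective (fun n : N => (1 : T) ⊗ₜ[R] n))
    {F M : Type u} [AddCommGroup F] [Module R F] [Module.Free R F] [Module.Finite R F]
    [AddCommGroup M] [Module R M] (K : Submodule R F) (hK : K.FG) (e : K →ₗ[R] M)
    (h : F →ₗ[R] T ⊗[R] M) (hc : ∀ k : K, h k = (1 : T) ⊗ₜ[R] e k) :
    ∃ h' : F →ₗ[R] M, ∀ k : K, h' k = e k := by
  classical
  have : Module.Finite R K := Module.Finite.of_fg hK
  obtain ⟨p, s, hs⟩ := Module.Finite.exists_fin (R := R) (M := K)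
  let b := Module.Free.chooseBasis R F
  let ι := Module.Free.ChooseBasisIndex R F
  let A : (ι → M) →ₗ[R] (Fin p → M) := LinearMap.pi fun j => ∑ i, b.repr (s j : F) i • LinearMap.proj i
  let z : Fin p → M := fun j => e (s j)
  have key : z ∈ LinearMap.range A := by
    rw [← Submodule.Quotient.mk_eq_zero]
    apply hpure
    simp only [tmul_zero]
    let u : T ⊗[R] (ι → M) := ∑ i, (LinearMap.single R (fun _ : ι => M) i).lTensor T (h (b i))
    have hA : ∀ i, A ∘ₗ (LinearMap.single R (fun _ : ι => M) i) =
        ∑ j, b.repr (s j : F) i • LinearMap.single R (fun _ : Fin p => M) j := by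
      intro i
      ext m j
      simp [A, Pi.single_apply, Finset.sum_apply]
    have hu : A.lTensor T u = (1 : T) ⊗ₜ[R] z := by
      have hz : z = ∑ j, LinearMap.single R (fun _ : Fin p => M) j (e (s j)) := by
        ext j; simp [z, Finset.sum_apply, Pi.single_apply]
      rw [hz, tmul_sum]
      simp only [u, map_sum, ← LinearMap.lTensor_comp_apply, hA]
      simp only [← LinearMap.coe_lTensorHom, map_sum, map_smul, LinearMap.sum_apply,
        LinearMap.smul_apply]
      simp only [LinearMap.coe_lTensorHom]
      rw [Finset.sum_comm]
      refine Finset.sum_congr rfl fun j _ => ?_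
      rw [← LinearMap.lTensor_tmul, ← hc]
      conv_rhs => rw [← b.sum_repr (s j : F)]
      simp only [map_sum, map_smul]
      rfl
    have : (1 : T) ⊗ₜ[R] (Submodule.Quotient.mk z : (Fin p → M) ⧸ LinearMap.range A) =
        (LinearMap.range A).mkQ.lTensor T ((1 : T) ⊗ₜ[R] z) := rfl
    rw [this, ← hu, ← LinearMap.lTensor_comp_apply, LinearMap.range_mkQ_comp]
    simp
  obtain ⟨v, hv⟩ := key
  refine ⟨b.constr R v, ?_⟩
  have : (b.constr R v) ∘ₗ K.subtype = e := by
    refine LinearMap.ext_on_range hs fun j => ?_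
    have := congrFun hv j
    simp only [A, z, LinearMap.pi_apply] at this
    rw [← this]
    simp [Module.Basis.constr_apply_fintype]
  intro k
  exact congr($this k)

lemma ext_pure_inj [IsNoetherianRing R] (hpure : ∀ (N : Type u) [AddCommGroup N] [Module R N],
    Function.Injective (fun n : N => (1 : T) ⊗ₜ[R] n))
    (M : Type u) [AddCommGroup M] [Module R M] (i : ℕ) :
    ∀ (X : Type u) [AddCommGroup X] [Module R X] [Module.Finite R X]
    (e : NExt (ModuleCat.of R X) (ModuleCat.of R M) i)
    (_ : e.comp (Abelian.Ext.mk₀ (ModuleCat.ofHom (TensorProduct.mk R T M 1))) (add_zero i) = 0),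
    e = 0 := by
  have hmono : Mono (ModuleCat.ofHom (TensorProduct.mk R T M 1)) :=
    (ModuleCat.mono_iff_injective _).2 (hpure M)
  induction i with
  | zero =>
    intro X _ _ _ e he
    exact Abelian.Ext.postcomp_mk₀_injective_of_mono _ _ (he.trans (by simp))
  | succ i ih =>
    intro X _ _ _ e he
    obtain ⟨F, _, _, _, _, f, hf⟩ := Module.exists_finite_presentation R X
    have hS := LinearMap.shortExact_shortComplexKer hf
    obtain ⟨e', rfl⟩ := Abelian.Ext.contravariant_sequence_exact₃ hS _ e
      (Abelian.Ext.eq_zero_of_projective (P := ModuleCat.of R F) _) (add_comm 1 i)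
    rw [Abelian.Ext.comp_assoc_of_third_deg_zero] at he
    obtain ⟨x, hx⟩ := Abelian.Ext.contravariant_sequence_exact₁ hS _ _ _ he
    cases i with
    | succ i =>
      have : x = 0 := Abelian.Ext.eq_zero_of_projective (P := ModuleCat.of R F) x
      rw [this, Abelian.Ext.comp_zero] at hx
      rw [ih (LinearMap.ker f) e' hx.symm, Abelian.Ext.comp_zero]
    | zero =>
      obtain ⟨ε, rfl⟩ := Abelian.Ext.homEquiv₀.symm.surjective e'
      obtain ⟨h, rfl⟩ := Abelian.Ext.homEquiv₀.symm.surjective x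
      simp only [Abelian.Ext.homEquiv₀_symm_apply, Abelian.Ext.mk₀_comp_mk₀] at hx ⊢
      have hx' := Abelian.Ext.homEquiv₀.symm.injective hx
      obtain ⟨h', hh'⟩ := pure_lift hpure (LinearMap.ker f) (IsNoetherian.noetherian _) ε.hom h.hom
        (fun k => congr($hx' k))
      have : ε = f.shortComplexKer.f ≫ ModuleCat.ofHom h' := by
        ext k
        exact (hh' k).symm
      rw [this, ← Abelian.Ext.mk₀_comp_mk₀]
      exact hS.extClass_comp_assoc _

lemma lcv_of_pure [IsNoetherianRing R] (hpure : ∀ (N : Type u) [AddCommGroup N] [Module R N],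
    Function.Injective (fun n : N => (1 : T) ⊗ₜ[R] n))
    (M : Type u) [AddCommGroup M] [Module R M] (a : Ideal R) (i : ℕ)
    (h : LCV a (ModuleCat.of R (T ⊗[R] M)) i) : LCV a (ModuleCat.of R M) i := by
  intro n e
  obtain ⟨m, hm, h0⟩ := h n (e.comp
    (Abelian.Ext.mk₀ (ModuleCat.ofHom (TensorProduct.mk R T M 1))) (add_zero i))
  refine ⟨m, hm, ext_pure_inj hpure M i _ _ ?_⟩
  rw [← h0, Abelian.Ext.comp_assoc_of_third_deg_zero]
end pure

section lcles
variable {R : Type u} [CommRing R]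

lemma powQ_comp (a : Ideal R) {n m k : ℕ} (h : n ≤ m) (h' : m ≤ k) :
    powQ a h' ≫ powQ a h = powQ a (h.trans h') := by
  refine ModuleCat.hom_ext (LinearMap.ext fun x => ?_)
  obtain ⟨x, rfl⟩ := Submodule.Quotient.mk_surjective _ x
  rfl

lemma lcv_mid {S : ShortComplex (ModuleCat.{u} R)} (hS : S.ShortExact) (a : Ideal R) {i : ℕ}
    (h1 : LCV a S.X₁ i) (h3 : LCV a S.X₃ i) : LCV a S.X₂ i := by
  intro n e
  obtain ⟨m, hm, h0⟩ := h3 n (e.comp (Abelian.Ext.mk₀ S.g) (add_zero i))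
  rw [← Abelian.Ext.comp_assoc_of_third_deg_zero] at h0
  obtain ⟨x, hx⟩ := Abelian.Ext.covariant_sequence_exact₂ _ hS _ h0
  obtain ⟨k, hk, h0'⟩ := h1 m x
  refine ⟨k, hm.trans hk, ?_⟩
  rw [← powQ_comp a hm hk, ← Abelian.Ext.mk₀_comp_mk₀_assoc, ← hx,
    ← Abelian.Ext.comp_assoc_of_third_deg_zero, h0', Abelian.Ext.zero_comp]

lemma lcv_left {S : ShortComplex (ModuleCat.{u} R)} (hS : S.ShortExact) (a : Ideal R) {i : ℕ}
    (h2 : LCV a S.X₂ (i + 1)) (h3 : LCV a S.X₃ i) : LCV a S.X₁ (i + 1) := by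
  intro n e
  obtain ⟨m, hm, h0⟩ := h2 n (e.comp (Abelian.Ext.mk₀ S.f) (add_zero _))
  rw [← Abelian.Ext.comp_assoc_of_third_deg_zero] at h0
  obtain ⟨x, hx⟩ := Abelian.Ext.covariant_sequence_exact₁ _ hS _ h0 rfl
  obtain ⟨k, hk, h0'⟩ := h3 m x
  refine ⟨k, hm.trans hk, ?_⟩
  rw [← powQ_comp a hm hk, ← Abelian.Ext.mk₀_comp_mk₀_assoc, ← hx,
    ← Abelian.Ext.comp_assoc _ _ _ (zero_add i) rfl (by lia), h0', Abelian.Ext.zero_comp]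

lemma lcv_right {S : ShortComplex (ModuleCat.{u} R)} (hS : S.ShortExact) (a : Ideal R) {i : ℕ}
    (h1 : LCV a S.X₁ (i + 1)) (h2 : LCV a S.X₂ i) : LCV a S.X₃ i := by
  intro n e
  obtain ⟨m, hm, h0⟩ := h1 n (e.comp hS.extClass rfl)
  rw [← Abelian.Ext.comp_assoc _ _ _ (zero_add i) rfl (by lia)] at h0
  obtain ⟨x, hx⟩ := Abelian.Ext.covariant_sequence_exact₃ _ hS _ _ h0
  obtain ⟨k, hk, h0'⟩ := h2 m x
  refine ⟨k, hm.trans hk, ?_⟩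
  rw [← powQ_comp a hm hk, ← Abelian.Ext.mk₀_comp_mk₀_assoc, ← hx,
    ← Abelian.Ext.comp_assoc_of_third_deg_zero, h0', Abelian.Ext.zero_comp]

lemma lcv_of_injective (a : Ideal R) (Y : ModuleCat.{u} R) [Injective Y] (i : ℕ) :
    LCV a Y (i + 1) := fun n e => ⟨n, le_rfl, by
  rw [Abelian.Ext.eq_zero_of_injective e, Abelian.Ext.comp_zero]⟩

/-- killed by the `n`-th power -/
def Tors (a : Ideal R) {Y : Type u} [AddCommGroup Y] [Module R Y] (n : ℕ) (x : Y) : Prop :=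
  ∀ r ∈ a ^ n, r • x = 0

variable (a : Ideal R) {Y : Type u} [AddCommGroup Y] [Module R Y]

lemma Tors.mono {a : Ideal R} {n m : ℕ} {x : Y} (h : Tors a n x) (hnm : n ≤ m) : Tors a m x :=
  fun r hr => h r (Ideal.pow_le_pow_right hnm hr)

/-- the map from a torsion element -/
def qhom (n : ℕ) (x : Y) (hx : Tors a n x) : ModuleCat.of R (R ⧸ a ^ n) ⟶ ModuleCat.of R Y :=
  ModuleCat.ofHom (Submodule.liftQ (a ^ n) (LinearMap.toSpanSingleton R Y x) (fun r hr => by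
    simpa using hx r hr))

/-- the generator -/
def qone (n : ℕ) : R ⧸ a ^ n := Submodule.Quotient.mk 1

lemma qhom_one (n : ℕ) (x : Y) (hx : Tors a n x) : (qhom a n x hx).hom (qone a n) = x :=
  one_smul R x

lemma powQ_one {n m : ℕ} (h : n ≤ m) : (powQ a h).hom (qone a m) = qone a n := rfl

lemma qhom_ext {n : ℕ} {Z : ModuleCat.{u} R} (f g : ModuleCat.of R (R ⧸ a ^ n) ⟶ Z)
    (h : f.hom (qone a n) = g.hom (qone a n)) : f = g := by
  refine ModuleCat.hom_ext (LinearMap.ext fun x => ?_)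
  obtain ⟨r, rfl⟩ := Submodule.Quotient.mk_surjective _ x
  have : (Submodule.Quotient.mk r : R ⧸ a ^ n) = r • qone a n := by
    rw [qone, ← Submodule.Quotient.mk_smul, smul_eq_mul, mul_one]
  rw [this]
  exact (map_smul f.hom _ _).trans ((congrArg (r • ·) h).trans (map_smul g.hom _ _).symm)

lemma tors_hom {n : ℕ} {Z : ModuleCat.{u} R} (f : ModuleCat.of R (R ⧸ a ^ n) ⟶ Z) :
    Tors a n (f.hom (qone a n)) := by
  intro r hr
  have : r • qone a n = 0 := by
    rw [qone, ← Submodule.Quotient.mk_smul, Submodule.Quotient.mk_eq_zero, smul_eq_mul, mul_one]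
    exact hr
  rw [← map_smul]
  exact (congrArg f.hom this).trans (map_zero _)

lemma lcv_zero_iff : LCV a (ModuleCat.of R Y) 0 ↔ ∀ n, ∀ x : Y, Tors a n x → x = 0 := by
  constructor
  · intro h n x hx
    obtain ⟨m, hm, h0⟩ := h n (Abelian.Ext.mk₀ (qhom a n x hx))
    rw [Abelian.Ext.mk₀_comp_mk₀, Abelian.Ext.mk₀_eq_zero_iff] at h0
    rw [← qhom_one a n x hx, ← powQ_one a hm]
    exact congr($(h0).hom (qone a m))
  · intro h n e
    obtain ⟨f, rfl⟩ := Abelian.Ext.homEquiv₀.symm.surjective e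
    refine ⟨n, le_rfl, ?_⟩
    have : f = 0 := qhom_ext a f 0 (h n _ (tors_hom a f))
    simp [this]

lemma sur_of_lcv_one {S : ShortComplex (ModuleCat.{u} R)} (hS : S.ShortExact)
    (h1 : LCV a S.X₁ 1) (n : ℕ) (x : S.X₃) (hx : Tors a n x) :
    ∃ m, ∃ y : S.X₂, Tors a m y ∧ S.g.hom y = x := by
  obtain ⟨m, hm, h0⟩ := h1 n ((Abelian.Ext.mk₀ (qhom a n x hx)).comp hS.extClass (zero_add 1))
  rw [Abelian.Ext.mk₀_comp_mk₀_assoc] at h0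
  obtain ⟨z, hz⟩ := Abelian.Ext.covariant_sequence_exact₃ _ hS _ _ h0
  obtain ⟨f, rfl⟩ := Abelian.Ext.homEquiv₀.symm.surjective z
  simp only [Abelian.Ext.homEquiv₀_symm_apply, Abelian.Ext.mk₀_comp_mk₀] at hz
  have hz' := Abelian.Ext.homEquiv₀.symm.injective hz
  refine ⟨m, f.hom (qone a m), tors_hom a f, ?_⟩
  refine (congr($(hz').hom (qone a m))).trans ?_
  exact qhom_one a n x hx

lemma lcv_one_of_sur {S : ShortComplex (ModuleCat.{u} R)} (hS : S.ShortExact)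
    (h2 : LCV a S.X₂ 1)
    (H : ∀ n, ∀ x : S.X₃, Tors a n x → ∃ m, ∃ y : S.X₂, Tors a m y ∧ S.g.hom y = x) :
    LCV a S.X₁ 1 := by
  intro n e
  obtain ⟨m, hm, h0⟩ := h2 n (e.comp (Abelian.Ext.mk₀ S.f) (add_zero _))
  rw [← Abelian.Ext.comp_assoc_of_third_deg_zero] at h0
  obtain ⟨z, hz⟩ := Abelian.Ext.covariant_sequence_exact₁ _ hS _ h0 (zero_add 1)
  obtain ⟨f, rfl⟩ := Abelian.Ext.homEquiv₀.symm.surjective z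
  obtain ⟨k, y, hy, hyx⟩ := H m _ (tors_hom a f)
  let l := max m k
  have hf : powQ a (le_max_left m k) ≫ f = qhom a l y (hy.mono (le_max_right m k)) ≫ S.g := by
    refine qhom_ext a _ _ ?_
    refine Eq.trans ?_ ((congrArg S.g.hom (qhom_one a l y (hy.mono (le_max_right m k)))).trans hyx).symm
    exact congrArg f.hom (powQ_one a (le_max_left m k))
  refine ⟨l, hm.trans (le_max_left m k), ?_⟩
  rw [← powQ_comp a hm (le_max_left m k), ← Abelian.Ext.mk₀_comp_mk₀_assoc, ← hz]
  simp only [Abelian.Ext.homEquiv₀_symm_apply]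
  rw [Abelian.Ext.mk₀_comp_mk₀_assoc, hf, ← Abelian.Ext.mk₀_comp_mk₀_assoc, hS.comp_extClass,
    Abelian.Ext.comp_zero]
end lcles

section gam
variable {R : Type u} [CommRing R]

/-- the torsion submodule -/
def gam (a : Ideal R) (Y : Type u) [AddCommGroup Y] [Module R Y] : Submodule R Y where
  carrier := {x | ∃ n, Tors a n x}
  zero_mem' := ⟨0, fun r _ => smul_zero r⟩
  add_mem' := by
    rintro x y ⟨n, hn⟩ ⟨m, hm⟩
    refine ⟨max n m, fun r hr => ?_⟩
    rw [smul_add, hn.mono (le_max_left n m) r hr, hm.mono (le_max_right n m) r hr, add_zero]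
  smul_mem' := by
    rintro c x ⟨n, hn⟩
    refine ⟨n, fun r hr => ?_⟩
    rw [smul_comm, hn r hr, smul_zero]

lemma gam_injective [IsNoetherianRing R] (a : Ideal R) (J : Type u) [AddCommGroup J] [Module R J]
    [Module.Injective R J] : Module.Injective R (gam a J) := by
  apply Module.Baer.injective
  intro I g
  have hfg : Module.Finite R I := inferInstance
  obtain ⟨n, hn⟩ : ∃ n, ∀ x : I, Tors a n (g x : J) := by
    obtain ⟨k, s, hs⟩ := Module.Finite.exists_fin (R := R) (M := I)
    choose f hf using fun i : Fin k => (g (s i)).2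
    refine ⟨Finset.univ.sup f, fun x => ?_⟩
    have hx : x ∈ Submodule.span R (Set.range s) := hs ▸ trivial
    induction hx using Submodule.span_induction with
    | mem x hx =>
      obtain ⟨i, rfl⟩ := hx
      exact (hf i).mono (Finset.le_sup (Finset.mem_univ i))
    | zero => intro r hr; simp
    | add x y _ _ hx hy =>
      intro r hr
      rw [map_add, Submodule.coe_add, smul_add, hx r hr, hy r hr, add_zero]
    | smul c x _ hx =>
      intro r hr
      rw [map_smul, Submodule.coe_smul, smul_comm, hx r hr, smul_zero]
  obtain ⟨k, hk⟩ := Ideal.exists_pow_inf_eq_pow_smul a (M := R) I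
  let m := n + k
  have hI : ∀ x : I, (x : R) ∈ a ^ m → g x = 0 := by
    intro x hx
    have h1 : (x : R) ∈ a ^ n • I := by
      have h2 : (x : R) ∈ a ^ m • ⊤ ⊓ I := ⟨by simpa using hx, x.2⟩
      rw [hk m (by lia)] at h2
      have : m - k = n := by lia
      rw [this] at h2
      exact Submodule.smul_mono le_rfl inf_le_right h2
    have h3 : ∃ h : (x : R) ∈ I, g ⟨x, h⟩ = 0 := by
      refine Submodule.smul_induction_on h1 ?_ ?_
      · intro r hr y hy
        refine ⟨I.smul_mem r hy, ?_⟩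
        have := hn ⟨y, hy⟩ r hr
        ext
        rw [← Submodule.coe_smul, ← map_smul] at this
        exact this
      · rintro y z ⟨hy, hy'⟩ ⟨hz, hz'⟩
        refine ⟨I.add_mem hy hz, ?_⟩
        have : (⟨y + z, I.add_mem hy hz⟩ : I) = ⟨y, hy⟩ + ⟨z, hz⟩ := rfl
        rw [this, map_add, hy', hz', add_zero]
    exact h3.2
  let p : Submodule R I := Submodule.comap I.subtype (a ^ m)
  let ι : (I ⧸ p) →ₗ[R] (R ⧸ a ^ m) := Submodule.mapQ p (a ^ m) I.subtype le_rfl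
  have hι : Function.Injective ι := by
    rw [← LinearMap.ker_eq_bot, Submodule.ker_mapQ]
    simp [p]
  let g' : (I ⧸ p) →ₗ[R] J := Submodule.liftQ p ((gam a J).subtype ∘ₗ g) (fun x hx => by
    simp [hI x hx])
  obtain ⟨h, hh⟩ := Module.Injective.out ι hι g'
  let y := h (qone a m)
  have hy : Tors a m y := tors_hom a (ModuleCat.ofHom h)
  refine ⟨LinearMap.toSpanSingleton R _ ⟨y, m, hy⟩, fun x hx => ?_⟩
  ext
  have h1 := hh (Submodule.Quotient.mk ⟨x, hx⟩)
  have h2 : ι (Submodule.Quotient.mk ⟨x, hx⟩) = x • qone a m := by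
    rw [qone, ← Submodule.Quotient.mk_smul, smul_eq_mul, mul_one]
    rfl
  rw [h2, map_smul] at h1
  exact h1

lemma exists_injective_embedding (Y : Type u) [AddCommGroup Y] [Module R Y] :
    ∃ (J : Type u) (_ : AddCommGroup J) (_ : Module R J) (_ : Module.Injective R J)
      (f : Y →ₗ[R] J), Function.Injective f := by
  obtain ⟨⟨J, _, f, _⟩⟩ := EnoughInjectives.presentation (ModuleCat.of R Y)
  refine ⟨J, inferInstance, inferInstance, ?_, f.hom, (ModuleCat.mono_iff_injective f).1 inferInstance⟩
  exact Module.injective_module_of_injective_object R J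

/-- short complex of an injection -/
abbrev scq {Y J : Type u} [AddCommGroup Y] [Module R Y] [AddCommGroup J] [Module R J]
    (f : Y →ₗ[R] J) : ShortComplex (ModuleCat.{u} R) :=
  ModuleCat.shortComplexOfCompEqZero f (LinearMap.range f).mkQ (LinearMap.range_mkQ_comp f)

lemma scq_exact {Y J : Type u} [AddCommGroup Y] [Module R Y] [AddCommGroup J] [Module R J]
    (f : Y →ₗ[R] J) (hf : Function.Injective f) : (scq f).ShortExact := by
  refine ModuleCat.shortComplex_shortExact _ ?_ hf (Submodule.mkQ_surjective _)
  exact LinearMap.exact_map_mkQ_range f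

lemma lcv_of_torsion [IsNoetherianRing R] (a : Ideal R) (i : ℕ) :
    ∀ (G : Type u) [AddCommGroup G] [Module R G], (∀ x : G, ∃ n, Tors a n x) →
      LCV a (ModuleCat.of R G) (i + 1) := by
  induction i with
  | zero =>
    intro G _ _ hG
    obtain ⟨J, _, _, _, f, hf⟩ := exists_injective_embedding (R := R) G
    have := gam_injective a J
    let f' : G →ₗ[R] gam a J := f.codRestrict _ fun x => by
      obtain ⟨n, hn⟩ := hG x
      exact ⟨n, fun r hr => by rw [← map_smul, hn r hr, map_zero]⟩
    have hf' : Function.Injective f' := fun x y h => hf (congrArg Subtype.val h)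
    have hinj : Injective (ModuleCat.of R (gam a J)) := Module.injective_object_of_injective_module ..
    refine lcv_one_of_sur a (scq_exact f' hf') (lcv_of_injective a (ModuleCat.of R (gam a J)) 0) ?_
    intro n x hx
    obtain ⟨⟨y, m, hy⟩, rfl⟩ := Submodule.mkQ_surjective _ x
    exact ⟨m, ⟨y, m, hy⟩, fun r hr => Subtype.ext (hy r hr), rfl⟩
  | succ i ih =>
    intro G _ _ hG
    obtain ⟨J, _, _, _, f, hf⟩ := exists_injective_embedding (R := R) G
    have := gam_injective a J
    let f' : G →ₗ[R] gam a J := f.codRestrict _ fun x => by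
      obtain ⟨n, hn⟩ := hG x
      exact ⟨n, fun r hr => by rw [← map_smul, hn r hr, map_zero]⟩
    have hf' : Function.Injective f' := fun x y h => hf (congrArg Subtype.val h)
    have hinj : Injective (ModuleCat.of R (gam a J)) := Module.injective_object_of_injective_module ..
    refine lcv_left (scq_exact f' hf') a (lcv_of_injective a (ModuleCat.of R (gam a J)) _) ?_
    refine ih (gam a J ⧸ LinearMap.range f') ?_
    intro x
    obtain ⟨⟨y, m, hy⟩, rfl⟩ := Submodule.mkQ_surjective _ x
    refine ⟨m, fun r hr => ?_⟩
    rw [← map_smul]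
    have : r • (⟨y, m, hy⟩ : gam a J) = 0 := Subtype.ext (hy r hr)
    rw [this, map_zero]
end gam

section indep
variable {R T : Type u} [CommRing R] [CommRing T] [Algebra R T]

lemma tors_map (a : Ideal R) {N : Type u} [AddCommGroup N] [Module R N] [Module T N]
    [IsScalarTower R T N] (n : ℕ) (x : N) : Tors (a.map (algebraMap R T)) n x ↔ Tors a n x := by
  unfold Tors
  rw [← Ideal.map_pow]
  constructor
  · intro h r hr
    rw [← algebraMap_smul T]
    exact h _ (Ideal.mem_map_of_mem _ hr)
  · intro h t ht
    have : Ideal.map (algebraMap R T) (a ^ n) ≤ LinearMap.ker (LinearMap.toSpanSingleton T N x) := by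
      rw [Ideal.map, Ideal.span, Submodule.span_le]
      rintro _ ⟨r, hr, rfl⟩
      simpa using h r hr
    simpa using this ht

lemma ev_of_torsionfree [IsNoetherianRing R] (a : Ideal R) {Q : Type u} [AddCommGroup Q]
    [Module R Q] [Module T Q] [IsScalarTower R T Q] [Module.Injective T Q]
    (hQ : ∀ n, ∀ x : Q, Tors a n x → x = 0) (n i : ℕ) :
    EV (ModuleCat.of R (R ⧸ a ^ n)) (ModuleCat.of R Q) i := by
  obtain ⟨r, s, hs⟩ := Submodule.fg_iff_exists_fin_generating_family.1
    (IsNoetherian.noetherian (a ^ n))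
  have hsmem : ∀ j, s j ∈ a ^ n := fun j => hs ▸ Submodule.subset_span ⟨j, rfl⟩
  let d : Q →ₗ[T] (Fin r → Q) := LinearMap.pi fun j => LinearMap.lsmul T Q (algebraMap R T (s j))
  have hd : Function.Injective d := by
    rw [← LinearMap.ker_eq_bot, eq_bot_iff]
    intro x hx
    refine hQ n x fun t ht => ?_
    have hle : a ^ n ≤ LinearMap.ker (LinearMap.toSpanSingleton R Q x) := by
      rw [← hs, Submodule.span_le]
      rintro _ ⟨j, rfl⟩
      have := congrFun hx j
      simpa [d] using this
    simpa using hle ht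
  obtain ⟨h, hh⟩ := Module.Injective.out d hd LinearMap.id
  let ρ : Fin r → (ModuleCat.of R Q ⟶ ModuleCat.of R Q) := fun j =>
    ModuleCat.ofHom ((h ∘ₗ LinearMap.single T (fun _ => Q) j).restrictScalars R)
  have hid : 𝟙 (ModuleCat.of R Q) = ∑ j, s j • ρ j := by
    refine ModuleCat.hom_ext (LinearMap.ext fun x => ?_)
    have h1 := hh x
    have h2 : d x = ∑ j, s j • Pi.single j x := by
      ext j
      simp [d, Finset.sum_apply, Pi.single_apply]
    rw [h2, map_sum] at h1
    refine h1.symm.trans ?_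
    simp only [ModuleCat.hom_sum, LinearMap.sum_apply]
    refine Finset.sum_congr rfl fun j _ => ?_
    rw [← algebraMap_smul T, map_smul, algebraMap_smul]
    rfl
  intro e
  rw [← Abelian.Ext.comp_mk₀_id e, hid, Abelian.Ext.mk₀_sum, Abelian.Ext.comp_sum]
  refine Finset.sum_eq_zero fun j _ => ?_
  rw [Abelian.Ext.mk₀_smul, Abelian.Ext.comp_smul]
  generalize e.comp (Abelian.Ext.mk₀ (ρ j)) (add_zero i) = e'
  have hz : s j • 𝟙 (ModuleCat.of R (R ⧸ a ^ n)) = 0 := by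
    refine qhom_ext a _ _ ?_
    exact tors_hom a (𝟙 _) (s j) (hsmem j)
  have : s j • e' = (Abelian.Ext.mk₀ (s j • 𝟙 (ModuleCat.of R (R ⧸ a ^ n)))).comp e' (zero_add i) := by
    simp [Abelian.Ext.mk₀_smul]
  rw [this, hz]
  simp
end indep

section indep2
variable (R : Type u) {T : Type u} [CommRing R] [CommRing T] [Algebra R T]

/-- short complex of an injection, restricted -/
abbrev scr {Y J : Type u} [AddCommGroup Y] [Module R Y] [Module T Y] [IsScalarTower R T Y]
    [AddCommGroup J] [Module R J] [Module T J] [IsScalarTower R T J]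
    (f : Y →ₗ[T] J) : ShortComplex (ModuleCat.{u} R) :=
  ModuleCat.shortComplexOfCompEqZero (f.restrictScalars R)
    ((LinearMap.range f).mkQ.restrictScalars R)
    (LinearMap.ext fun x => congr($(LinearMap.range_mkQ_comp f) x))

lemma scr_exact {Y J : Type u} [AddCommGroup Y] [Module R Y] [Module T Y] [IsScalarTower R T Y]
    [AddCommGroup J] [Module R J] [Module T J] [IsScalarTower R T J]
    (f : Y →ₗ[T] J) (hf : Function.Injective f) : (scr R f).ShortExact := by
  refine ModuleCat.shortComplex_shortExact _ ?_ hf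
    (Submodule.mkQ_surjective (LinearMap.range f))
  exact LinearMap.exact_map_mkQ_range f

variable {R}

lemma lcv_restrict_injective [IsNoetherianRing R] [IsNoetherianRing T] (a : Ideal R)
    (J : Type u) [AddCommGroup J] [Module R J] [Module T J] [IsScalarTower R T J]
    [Module.Injective T J] (i : ℕ) : LCV a (ModuleCat.of R J) (i + 1) := by
  let b := a.map (algebraMap R T)
  let Γ := gam b J
  have hΓ : Module.Injective T Γ := gam_injective b J
  let Q := J ⧸ LinearMap.range Γ.subtype
  obtain ⟨ρ, hρ⟩ := Module.Injective.out Γ.subtype Γ.injective_subtype LinearMap.id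
  let s : Q →ₗ[T] J := Submodule.liftQ _ (LinearMap.id - Γ.subtype ∘ₗ ρ) (by
    rintro _ ⟨x, rfl⟩
    have := hρ x
    simp only [LinearMap.id_apply] at this
    rw [LinearMap.mem_ker, LinearMap.sub_apply, LinearMap.comp_apply, this, LinearMap.id_apply,
      sub_self])
  have hs : ∀ q : Q, Submodule.mkQ _ (s q) = q := by
    intro q
    obtain ⟨y, rfl⟩ := Submodule.mkQ_surjective _ q
    have : s (Submodule.mkQ _ y) = y - Γ.subtype (ρ y) := rfl
    rw [this, map_sub, sub_eq_self, ← LinearMap.comp_apply, LinearMap.range_mkQ_comp,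
      LinearMap.zero_apply]
  have hQ : Module.Injective T Q := by
    constructor
    intro X Y _ _ _ _ f hf g
    obtain ⟨h, hh⟩ := Module.Injective.out f hf (s ∘ₗ g)
    exact ⟨Submodule.mkQ _ ∘ₗ h, fun x => by simp only [LinearMap.comp_apply, hh, hs]⟩
  have htf : ∀ n, ∀ x : Q, Tors a n x → x = 0 := by
    intro n x hx
    have h1 : s x ∈ Γ := ⟨n, (tors_map a n _).2 fun r hr => by
      rw [← LinearMap.map_smul_of_tower, hx r hr, map_zero]⟩
    rw [← hs x, ← LinearMap.mem_ker, Submodule.ker_mkQ]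
    exact ⟨⟨_, h1⟩, rfl⟩
  refine lcv_mid (scr_exact R Γ.subtype Γ.injective_subtype) a ?_ ?_
  · refine lcv_of_torsion a i Γ ?_
    rintro ⟨x, n, hn⟩
    exact ⟨n, fun r hr => Subtype.ext ((tors_map a n x).1 hn r hr)⟩
  · intro n e
    refine ⟨n, le_rfl, ?_⟩
    rw [ev_of_torsionfree (T := T) a (Q := Q) htf n (i + 1) e, Abelian.Ext.comp_zero]

lemma lcv_restrict [IsNoetherianRing R] [IsNoetherianRing T] (a : Ideal R) (i : ℕ) :
    ∀ (N : Type u) [AddCommGroup N] [Module R N] [Module T N] [IsScalarTower R T N],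
      LCV (a.map (algebraMap R T)) (ModuleCat.of T N) i → LCV a (ModuleCat.of R N) i := by
  induction i with
  | zero =>
    intro N _ _ _ _ h
    rw [lcv_zero_iff] at h ⊢
    intro n x hx
    exact h n x ((tors_map a n x).2 hx)
  | succ i ih =>
    intro N _ _ _ _ h
    obtain ⟨J, _, _, _, f, hf⟩ := exists_injective_embedding (R := T) N
    let _ : Module R J := Module.compHom J (algebraMap R T)
    have : IsScalarTower R T J := IsScalarTower.of_algebraMap_smul fun _ _ => rfl
    have hJ := lcv_restrict_injective (T := T) a J i
    cases i with
    | zero =>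
      refine lcv_one_of_sur a (scr_exact R f hf) hJ ?_
      intro n x hx
      obtain ⟨m, y, hy, hyx⟩ := sur_of_lcv_one _ (scq_exact f hf) h n x ((tors_map a n x).2 hx)
      exact ⟨m, y, (tors_map a m y).1 hy, hyx⟩
    | succ i =>
      have hinj : Injective (ModuleCat.of T J) := Module.injective_object_of_injective_module ..
      refine lcv_left (scr_exact R f hf) a hJ ?_
      refine ih (J ⧸ LinearMap.range f) ?_
      exact lcv_right (scq_exact f hf) _ h (lcv_of_injective _ (ModuleCat.of T J) i)
end indep2

section final
variable {R : Type u} [CommRing R]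

lemma cohDim_set_iff (a : Ideal R) (M : Type u) [AddCommGroup M] [Module R M] (i : ℕ) :
    Nontrivial ((localCohomology a i).obj (ModuleCat.of R M)) ↔ ¬ LCV a (ModuleCat.of R M) i := by
  rw [← not_subsingleton_iff_nontrivial, lc_subsingleton_iff]

lemma relGrade_set_iff (a : Ideal R) (M : Type u) [AddCommGroup M] [Module R M] (i : ℕ) :
    Nontrivial (((Ext R (ModuleCat.{u} R) i).obj
      (Opposite.op (ModuleCat.of R (R ⧸ a)))).obj (ModuleCat.of R M)) ↔
      ¬ EV (ModuleCat.of R (R ⧸ a)) (ModuleCat.of R M) i := by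
  rw [← not_subsingleton_iff_nontrivial, ext_subsingleton_iff]
  rfl

lemma relGrade_eq_iff (a : Ideal R) (M : Type u) [AddCommGroup M] [Module R M] (g : ℕ)
    (hlt : ∀ j < g, EV (ModuleCat.of R (R ⧸ a)) (ModuleCat.of R M) j)
    (hg : ¬ EV (ModuleCat.of R (R ⧸ a)) (ModuleCat.of R M) g) : relGrade a M = g := by
  apply le_antisymm
  · exact sInf_le ⟨g, (relGrade_set_iff a M g).2 hg, rfl⟩
  · refine le_sInf ?_
    rintro _ ⟨j, hj, rfl⟩
    have hj' := (relGrade_set_iff a M j).1 hj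
    by_contra hcon
    exact hj' (hlt j (by simpa using hcon))

lemma exists_grade (a : Ideal R) (M : Type u) [AddCommGroup M] [Module R M]
    (h : ¬ ∀ i, EV (ModuleCat.of R (R ⧸ a)) (ModuleCat.of R M) i) :
    ∃ g : ℕ, (∀ j < g, EV (ModuleCat.of R (R ⧸ a)) (ModuleCat.of R M) j) ∧
      ¬ EV (ModuleCat.of R (R ⧸ a)) (ModuleCat.of R M) g := by
  classical
  push Not at h
  refine ⟨Nat.find h, fun j hj => ?_, Nat.find_spec h⟩
  exact not_not.1 (Nat.find_min h hj)

lemma lcv_of_all_ev [IsNoetherianRing R] (a : Ideal R) (M : Type u) [AddCommGroup M] [Module R M]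
    (h : ∀ i, EV (ModuleCat.of R (R ⧸ a)) (ModuleCat.of R M) i) (i : ℕ) :
    LCV a (ModuleCat.of R M) i :=
  lcv_below a (i + 1) (fun j _ => h j) i (Nat.lt_succ_self i)

lemma exists_conc [IsNoetherianRing R] (a : Ideal R) (M : Type u) [AddCommGroup M] [Module R M]
    (h : relGrade a M = cohDim a M) :
    ∃ g : ℕ, ∀ i, i ≠ g → LCV a (ModuleCat.of R M) i := by
  by_cases hall : ∀ i, EV (ModuleCat.of R (R ⧸ a)) (ModuleCat.of R M) i
  · exact ⟨0, fun i _ => lcv_of_all_ev a M hall i⟩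
  obtain ⟨g, hlt, hg⟩ := exists_grade a M hall
  refine ⟨g, fun i hi => ?_⟩
  rcases lt_or_gt_of_ne hi with hi | hi
  · exact lcv_below a g hlt i hi
  · by_contra hcon
    have h1 : (i : ℕ∞) ≤ cohDim a M := le_sSup ⟨i, (cohDim_set_iff a M i).2 hcon, rfl⟩
    rw [← h, relGrade_eq_iff a M g hlt hg] at h1
    have : i ≤ g := by exact_mod_cast h1
    lia

end final

theorem stmt2 {R T : Type u} [CommRing R] [CommRing T] [Algebra R T]
    [IsNoetherianRing R] [IsNoetherianRing T]
    (hpure : IsPureAlgebra R T) (a : Ideal R) (ha : a ≠ ⊤)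
    (M : Type u) [AddCommGroup M] [Module R M] [Module.Finite R M]
    (h : IsRelCM (a.map (algebraMap R T)) (T ⊗[R] M)) :
    IsRelCM a M := by
  by_cases haM : a • (⊤ : Submodule R M) = ⊤
  · exact Or.inl haM
  rcases h with h | ⟨-, h⟩
  · exfalso
    apply haM
    have hsub : Subsingleton (T ⊗[R] (M ⧸ a • (⊤ : Submodule R M))) := by
      refine subsingleton_of_forall_eq 0 fun x => ?_
      let π : T ⊗[R] M →ₗ[T] T ⊗[R] (M ⧸ a • (⊤ : Submodule R M)) :=
        LinearMap.baseChange T (a • (⊤ : Submodule R M)).mkQ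
      have hπ : Function.Surjective π :=
        LinearMap.lTensor_surjective T (Submodule.mkQ_surjective _)
      have hkill : ∀ r ∈ a, ∀ y : T ⊗[R] (M ⧸ a • (⊤ : Submodule R M)), r • y = 0 := by
        intro r hr y
        induction y using TensorProduct.induction_on with
        | zero => simp
        | add y z hy hz => rw [smul_add, hy, hz, add_zero]
        | tmul t m =>
          obtain ⟨m, rfl⟩ := Submodule.mkQ_surjective _ m
          rw [← tmul_smul, ← map_smul]
          have : (a • (⊤ : Submodule R M)).mkQ (r • m) = 0 := by
            rw [← LinearMap.mem_ker, Submodule.ker_mkQ]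
            exact Submodule.smul_mem_smul hr trivial
          rw [this, tmul_zero]
      obtain ⟨y, rfl⟩ := hπ x
      have hy : y ∈ a.map (algebraMap R T) • (⊤ : Submodule T (T ⊗[R] M)) := by
        rw [h]; trivial
      refine Submodule.smul_induction_on hy ?_ ?_
      · intro t ht z _
        rw [map_smul]
        have h1 : Tors (a.map (algebraMap R T)) 1 (π z) :=
          (tors_map a 1 _).2 fun r hr => hkill r (by simpa using hr) _
        exact h1 t (by simpa using ht)
      · intro u v hu hv
        rw [map_add, hu, hv, add_zero]
    have hsub2 : Subsingleton (M ⧸ a • (⊤ : Submodule R M)) :=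
      (hpure (M ⧸ a • (⊤ : Submodule R M))).subsingleton
    exact Submodule.Quotient.subsingleton_iff.1 hsub2
  · obtain ⟨g, hg⟩ := exists_conc _ _ h
    have hM : ∀ i, i ≠ g → LCV a (ModuleCat.of R M) i := fun i hi =>
      lcv_of_pure hpure M a i (lcv_restrict a i (T ⊗[R] M) (hg i hi))
    obtain ⟨g', hlt, hg'⟩ := exists_grade a M fun hall => haM (eq_top_of_all_ev a M hall)
    have hn : ¬ LCV a (ModuleCat.of R M) g' := fun hl => hg' (not_lcv_grade a g' hlt hl)
    have hgg : g' = g := by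
      by_contra hne
      exact hn (hM g' hne)
    subst hgg
    refine Or.inr ⟨haM, ?_⟩
    rw [relGrade_eq_iff a M g' hlt hg']
    apply le_antisymm
    · exact le_sSup ⟨g', (cohDim_set_iff a M g').2 hn, rfl⟩
    · refine sSup_le ?_
      rintro _ ⟨i, hi, rfl⟩
      have hi' := (cohDim_set_iff a M i).1 hi
      have : i = g' := by
        by_contra hne
        exact hi' (hM i hne)
      rw [this]

end
end
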